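/- arXiv:0802.1739 — 4 statements merged into one kernel-verified Lean document; each statement's English description precedes it below -/
import Mathlib

section
/- Let n ≥ 2 and N ≤ n+1. Suppose f : B_n → ℂ^N and g : B_n → ℂ^N are proper holomorphic maps from B_n to B_N with f(0) = g(0) = 0, and suppose that for every λ ∈ [0,1] there exists a proper holomorphic map h_λ from B_n to B_N with ‖h_λ(z)‖² = λ‖f(z)‖² + (1−λ)‖g(z)‖² for all z ∈ B_n. Then ‖f(z)‖² = ‖g(z)‖² for all z ∈ B_n. (Equivalently: for n ≥ 2, a positive-dimensional convex family of origin-preserving proper holomorphic maps from B_n to B_N can exist only if N ≥ n+2.) -/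
/-- A proper holomorphic map from the unit ball `B_n ⊆ ℂ^n` to the unit ball
`B_N ⊆ ℂ^N`: it is holomorphic on the ball, maps the ball into the ball, and
`‖f(z_j)‖ → 1` for every sequence in the ball with `‖z_j‖ → 1`. -/
def IsProperBallMap (n N : ℕ)
    (f : EuclideanSpace ℂ (Fin n) → EuclideanSpace ℂ (Fin N)) : Prop :=
  DifferentiableOn ℂ f (Metric.ball 0 1) ∧
  (∀ z ∈ Metric.ball (0 : EuclideanSpace ℂ (Fin n)) 1, ‖f z‖ < 1) ∧
  (∀ u : ℕ → EuclideanSpace ℂ (Fin n),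
    (∀ j, u j ∈ Metric.ball (0 : EuclideanSpace ℂ (Fin n)) 1) →
    Filter.Tendsto (fun j => ‖u j‖) Filter.atTop (nhds 1) →
    Filter.Tendsto (fun j => ‖f (u j)‖) Filter.atTop (nhds 1))


open Filter Topology

lemma core_one_var {ι : Type*} [Fintype ι] (c : ι → ℝ) (ψ : ι → ℂ → ℂ)
    (hψ : ∀ i, ∀ᶠ t in 𝓝 (0 : ℂ), DifferentiableAt ℂ (ψ i) t)
    (hneg : ∀ i, c i < 0 → deriv (ψ i) 0 = 0) (l : ℂ) (κ : ℝ) (hκ : 0 < κ) :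
    ¬ ∀ᶠ t in 𝓝 (0 : ℂ), ∑ i, c i * ‖ψ i t‖ ^ 2 + (κ * ‖t‖ ^ 2 + (l * t).re)
      ≤ ∑ i, c i * ‖ψ i 0‖ ^ 2 := by
  intro hmax
  set Ψ : ℂ → ℂ := fun t =>
    ∑ i, (2 * c i : ℂ) * (starRingEnd ℂ (ψ i 0)) * (ψ i t - ψ i 0) + l * t with hΨ
  have key : ∀ i, ∀ t, c i * ‖ψ i t‖ ^ 2 = c i * ‖ψ i 0‖ ^ 2 +
      ((2 * c i : ℂ) * (starRingEnd ℂ (ψ i 0)) * (ψ i t - ψ i 0)).re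
      + c i * ‖ψ i t - ψ i 0‖ ^ 2 := by
    intro i t
    simp only [← Complex.normSq_eq_norm_sq, Complex.normSq_apply]
    simp
    ring
  set δ : ℝ := κ / (2 * (Fintype.card ι + 1)) with hδ
  have hδ0 : 0 < δ := by positivity
  have small : ∀ i, ∀ᶠ t in 𝓝 (0 : ℂ), - (δ * ‖t‖ ^ 2) ≤ c i * ‖ψ i t - ψ i 0‖ ^ 2 := by
    intro i
    by_cases hc : c i < 0
    · have hd : HasDerivAt (ψ i) 0 0 := by
        simpa only [hneg i hc] using (hψ i).self_of_nhds.hasDerivAt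
      have ho := hd.isLittleO
      simp only [sub_zero, smul_zero] at ho
      have hη : 0 < Real.sqrt (δ / (-c i)) := Real.sqrt_pos.mpr (div_pos hδ0 (by linarith))
      filter_upwards [ho.def hη] with t ht
      have h2 : ‖ψ i t - ψ i 0‖ ^ 2 ≤ (Real.sqrt (δ / (-c i)) * ‖t‖) ^ 2 :=
        pow_le_pow_left₀ (norm_nonneg _) ht 2
      rw [mul_pow, Real.sq_sqrt (div_pos hδ0 (by linarith)).le] at h2
      have h3 : (-c i) * ‖ψ i t - ψ i 0‖ ^ 2 ≤ (-c i) * (δ / (-c i) * ‖t‖ ^ 2) :=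
        mul_le_mul_of_nonneg_left h2 (by linarith)
      have h4 : (-c i) * (δ / (-c i) * ‖t‖ ^ 2) = δ * ‖t‖ ^ 2 := by
        have : -c i ≠ 0 := by linarith
        rw [← mul_assoc, mul_div_cancel₀ _ this]
      linarith
    · push Not at hc
      filter_upwards with t
      have : 0 ≤ c i * ‖ψ i t - ψ i 0‖ ^ 2 := by positivity
      have : 0 ≤ δ * ‖t‖ ^ 2 := by positivity
      linarith
  have small' : ∀ᶠ t in 𝓝 (0 : ℂ), ∀ i, - (δ * ‖t‖ ^ 2) ≤ c i * ‖ψ i t - ψ i 0‖ ^ 2 :=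
    eventually_all.mpr small
  have hre : ∀ᶠ t in 𝓝 (0 : ℂ), (Ψ t).re ≤ - (κ / 2 * ‖t‖ ^ 2) := by
    filter_upwards [hmax, small'] with t h1 h2
    have e : ∑ i, c i * ‖ψ i t‖ ^ 2 = ∑ i, c i * ‖ψ i 0‖ ^ 2 + ((Ψ t).re - (l * t).re)
        + ∑ i, c i * ‖ψ i t - ψ i 0‖ ^ 2 := by
      simp only [hΨ, Complex.add_re, Complex.re_sum, add_sub_cancel_right]
      rw [← Finset.sum_add_distrib, ← Finset.sum_add_distrib]
      exact Finset.sum_congr rfl fun i _ => key i t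
    have s : ∑ i : ι, (- (δ * ‖t‖ ^ 2)) ≤ ∑ i, c i * ‖ψ i t - ψ i 0‖ ^ 2 :=
      Finset.sum_le_sum fun i _ => h2 i
    rw [Finset.sum_const, nsmul_eq_mul, Finset.card_univ] at s
    have hk : (Fintype.card ι : ℝ) * δ ≤ κ / 2 := by
      rw [hδ]
      have : (0:ℝ) < Fintype.card ι + 1 := by positivity
      rw [mul_div_assoc', div_le_div_iff₀ (by positivity) (by positivity)]
      nlinarith
    have hk2 := mul_le_mul_of_nonneg_right hk (sq_nonneg ‖t‖)
    nlinarith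
  have h0 : Ψ 0 = 0 := by simp [hΨ]
  have hd : ∀ᶠ t in 𝓝 (0 : ℂ), DifferentiableAt ℂ (fun t => Complex.exp (Ψ t)) t := by
    filter_upwards [eventually_all.mpr hψ] with t ht
    apply DifferentiableAt.cexp
    simp only [hΨ]
    fun_prop (disch := exact ht _)
  have hloc : IsLocalMax (norm ∘ fun t => Complex.exp (Ψ t)) 0 := by
    filter_upwards [hre] with t ht
    simp only [Function.comp, Complex.norm_exp, h0, Complex.zero_re]
    apply Real.exp_le_exp.mpr
    have : 0 ≤ κ / 2 * ‖t‖ ^ 2 := by positivity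
    linarith
  have hc := Complex.eventually_eq_of_isLocalMax_norm hd hloc
  have hboth := (hc.and hre)
  obtain ⟨ρ, hρ, hb⟩ := Metric.eventually_nhds_iff.mp hboth
  have hmem : dist ((ρ / 2 : ℝ) : ℂ) 0 < ρ := by
    rw [dist_zero_right, Complex.norm_real, Real.norm_of_nonneg (by linarith)]; linarith
  obtain ⟨e1, e2⟩ := hb hmem
  have e3 := congrArg norm e1
  simp only [Complex.norm_exp, h0, Complex.zero_re] at e3
  have e4 := Real.exp_injective e3
  rw [e4, Complex.norm_real, Real.norm_of_nonneg (by linarith)] at e2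
  have : 0 < κ / 2 * (ρ / 2) ^ 2 := by positivity
  linarith

lemma no_loc_max {n : ℕ} {ι : Type*} [Fintype ι] (c : ι → ℝ)
    (φ : ι → EuclideanSpace ℂ (Fin n) → ℂ)
    (hφ : ∀ i, DifferentiableOn ℂ (φ i) (Metric.ball 0 1))
    (hneg : Fintype.card {i // c i < 0} < n) (ε : ℝ) (hε : 0 < ε)
    (q : EuclideanSpace ℂ (Fin n)) (hq : q ∈ Metric.ball (0 : EuclideanSpace ℂ (Fin n)) 1) :
    ¬ IsLocalMax (fun z => ∑ i, c i * ‖φ i z‖ ^ 2 + ε * ‖z‖ ^ 2) q := by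
  intro hmax
  have hda : ∀ i, DifferentiableAt ℂ (φ i) q := fun i =>
    (hφ i).differentiableAt (Metric.isOpen_ball.mem_nhds hq)
  let Λ : EuclideanSpace ℂ (Fin n) →ₗ[ℂ] ({i // c i < 0} → ℂ) :=
    LinearMap.pi fun i => (fderiv ℂ (φ i.1) q).toLinearMap
  have hker : LinearMap.ker Λ ≠ ⊥ := by
    apply LinearMap.ker_ne_bot_of_finrank_lt
    simpa using hneg
  obtain ⟨ξ, hξ, hξ0⟩ := (Submodule.ne_bot_iff _).mp hker
  have hline : Continuous fun t : ℂ => q + t • ξ := by fun_prop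
  have hl0 : Tendsto (fun t : ℂ => q + t • ξ) (𝓝 0) (𝓝 q) := by
    have := hline.tendsto 0
    simpa using this
  have hld : ∀ t : ℂ, HasDerivAt (fun t : ℂ => q + t • ξ) ξ t := by
    intro t
    simpa using ((hasDerivAt_id t).smul_const ξ).const_add q
  refine core_one_var c (fun i t => φ i (q + t • ξ)) ?_ ?_ (ε * 2 * inner ℂ q ξ)
    (ε * ‖ξ‖ ^ 2) (by positivity) ?_
  · intro i
    filter_upwards [hl0.eventually (Metric.isOpen_ball.mem_nhds hq)] with t ht
    exact ((hφ i).differentiableAt (Metric.isOpen_ball.mem_nhds ht)).comp t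
      (hld t).differentiableAt
  · intro i hi
    have h1 : HasFDerivAt (φ i) (fderiv ℂ (φ i) q) (q + (0 : ℂ) • ξ) := by
      simpa using (hda i).hasFDerivAt
    have h2 := h1.comp_hasDerivAt (0 : ℂ) (hld 0)
    have h3 := h2.deriv
    have h4 : Λ ξ = 0 := hξ
    have h5 := congrFun h4 ⟨i, hi⟩
    simp only [Λ, LinearMap.pi_apply] at h5
    exact h3.trans h5
  · filter_upwards [hl0.eventually hmax] with t ht
    have hn : ‖q + t • ξ‖ ^ 2 = ‖q‖ ^ 2 + 2 * (t * inner ℂ q ξ).re + ‖t‖ ^ 2 * ‖ξ‖ ^ 2 := by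
      rw [@norm_add_sq ℂ, inner_smul_right, norm_smul, mul_pow]
      rfl
    rw [hn] at ht
    simp only [zero_smul, add_zero]
    have e : ((ε * 2 * inner ℂ q ξ : ℂ) * t).re = ε * (2 * (t * inner ℂ q ξ).re) := by
      simp [Complex.mul_re, Complex.mul_im]; ring
    rw [e]
    linarith

lemma max_principle {n : ℕ} {ι : Type*} [Fintype ι] (c : ι → ℝ)
    (φ : ι → EuclideanSpace ℂ (Fin n) → ℂ)
    (hφ : ∀ i, DifferentiableOn ℂ (φ i) (Metric.ball 0 1))
    (hneg : Fintype.card {i // c i < 0} < n) (r C : ℝ) (hr1 : r < 1)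
    (hC : ∀ z, ‖z‖ = r → ∑ i, c i * ‖φ i z‖ ^ 2 ≤ C) (p : EuclideanSpace ℂ (Fin n))
    (hp : ‖p‖ ≤ r) : ∑ i, c i * ‖φ i p‖ ^ 2 ≤ C := by
  by_contra hlt
  push Not at hlt
  set u : EuclideanSpace ℂ (Fin n) → ℝ := fun z => ∑ i, c i * ‖φ i z‖ ^ 2 with hu
  set ε := (u p - C) / 2 with hε
  have hε0 : 0 < ε := by
    have : C < u p := hlt
    linarith
  have hr0 : 0 ≤ r := (norm_nonneg p).trans hp
  have hsub : Metric.closedBall (0 : EuclideanSpace ℂ (Fin n)) r ⊆ Metric.ball 0 1 :=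
    Metric.closedBall_subset_ball hr1
  have hcont : ContinuousOn (fun z => u z + ε * ‖z‖ ^ 2)
      (Metric.closedBall (0 : EuclideanSpace ℂ (Fin n)) r) := by
    have : ∀ i, ContinuousOn (φ i) (Metric.closedBall (0 : EuclideanSpace ℂ (Fin n)) r) :=
      fun i => (hφ i).continuousOn.mono hsub
    simp only [hu]
    fun_prop
  have hpm : p ∈ Metric.closedBall (0 : EuclideanSpace ℂ (Fin n)) r := by simpa using hp
  obtain ⟨q, hq, hqmax⟩ := (isCompact_closedBall (0 : EuclideanSpace ℂ (Fin n)) r).exists_isMaxOn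
    ⟨p, hpm⟩ hcont
  have hqp : u p + ε * ‖p‖ ^ 2 ≤ u q + ε * ‖q‖ ^ 2 := hqmax hpm
  have hqr : ‖q‖ ≤ r := by simpa using hq
  have hqlt : ‖q‖ < r := by
    rcases hqr.lt_or_eq with h | h
    · exact h
    · exfalso
      have h1 : u q ≤ C := hC q h
      have h2 : ‖q‖ ^ 2 ≤ 1 := by nlinarith [norm_nonneg q]
      have h3 : ε * ‖q‖ ^ 2 ≤ ε * 1 := mul_le_mul_of_nonneg_left h2 hε0.le
      have h4 : 0 ≤ ε * ‖p‖ ^ 2 := by positivity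
      linarith
  refine no_loc_max c φ hφ hneg ε hε0 q (hsub hq) ?_
  have : Metric.closedBall (0 : EuclideanSpace ℂ (Fin n)) r ∈ 𝓝 q :=
    mem_of_superset (Metric.isOpen_ball.mem_nhds (by simpa using hqlt))
      Metric.ball_subset_closedBall
  exact hqmax.isLocalMax this

lemma proper_bound {n N : ℕ} {f : EuclideanSpace ℂ (Fin n) → EuclideanSpace ℂ (Fin N)}
    (hf : IsProperBallMap n N f) (ε : ℝ) (hε : 0 < ε) :
    ∃ r₀ < 1, ∀ z, r₀ < ‖z‖ → ‖z‖ < 1 → 1 - ε < ‖f z‖ := by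
  by_contra hcon
  push Not at hcon
  have hk : ∀ k : ℕ, (1 : ℝ) - 1 / (k + 1) < 1 := fun k => by
    have : (0 : ℝ) < 1 / (k + 1) := by positivity
    linarith
  choose u hu1 hu2 hu3 using fun k : ℕ => hcon (1 - 1 / (k + 1)) (hk k)
  have ht : Tendsto (fun j => ‖u j‖) atTop (𝓝 1) := by
    refine tendsto_of_tendsto_of_tendsto_of_le_of_le (g := fun k : ℕ => (1 : ℝ) - 1 / (k + 1))
      (h := fun _ => 1) ?_ tendsto_const_nhds (fun k => (hu1 k).le) (fun k => (hu2 k).le)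
    simpa using (tendsto_one_div_add_atTop_nhds_zero_nat (𝕜 := ℝ)).const_sub 1
  have h := hf.2.2 u (fun j => by simpa using hu2 j) ht
  have := le_of_tendsto' h hu3
  linarith

lemma nonpos_of_few_neg {n N : ℕ} {ι : Type*} [Fintype ι] (c : ι → ℝ)
    (φ : ι → EuclideanSpace ℂ (Fin n) → ℂ)
    (hφ : ∀ i, DifferentiableOn ℂ (φ i) (Metric.ball 0 1))
    (hneg : Fintype.card {i // c i < 0} < n)
    {f g : EuclideanSpace ℂ (Fin n) → EuclideanSpace ℂ (Fin N)}
    (hf : IsProperBallMap n N f) (hg : IsProperBallMap n N g)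
    (hu : ∀ z ∈ Metric.ball (0 : EuclideanSpace ℂ (Fin n)) 1,
      ∑ i, c i * ‖φ i z‖ ^ 2 = ‖f z‖ ^ 2 - ‖g z‖ ^ 2) :
    ∀ z ∈ Metric.ball (0 : EuclideanSpace ℂ (Fin n)) 1, ‖f z‖ ^ 2 ≤ ‖g z‖ ^ 2 := by
  intro z hz
  have hz1 : ‖z‖ < 1 := by simpa using hz
  refine le_of_forall_pos_le_add fun ε hε => ?_
  obtain ⟨r₀, hr₀, hb⟩ := proper_bound hg (ε / 2) (by positivity)
  obtain ⟨r, hr, hr1⟩ := exists_between (max_lt hr₀ hz1)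
  have := max_principle c φ hφ hneg r ε hr1 (fun w hw => ?_) z
    ((le_max_right _ _).trans hr.le)
  · rw [hu z hz] at this; linarith
  · have hwm : w ∈ Metric.ball (0 : EuclideanSpace ℂ (Fin n)) 1 := by simpa [hw] using hr1
    rw [hu w hwm]
    have h1 := hb w (by rw [hw]; exact (le_max_left _ _).trans_lt hr) (by rw [hw]; exact hr1)
    have h2 := hf.2.1 w hwm
    have h3 := hg.2.1 w hwm
    nlinarith [norm_nonneg (f w), norm_nonneg (g w)]

lemma half {n N : ℕ} (hn : 2 ≤ n) (hN : N ≤ n + 1) (c : Fin N → ℝ)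
    (φ : Fin N → EuclideanSpace ℂ (Fin n) → ℂ)
    (hφ : ∀ i, DifferentiableOn ℂ (φ i) (Metric.ball 0 1))
    {f g h : EuclideanSpace ℂ (Fin n) → EuclideanSpace ℂ (Fin N)}
    (hf : IsProperBallMap n N f) (hg : IsProperBallMap n N g) (hh : IsProperBallMap n N h)
    (h0 : h 0 = 0)
    (hhφ : ∀ z, ‖h z‖ ^ 2 = ∑ i, ‖φ i z‖ ^ 2)
    (hu : ∀ z ∈ Metric.ball (0 : EuclideanSpace ℂ (Fin n)) 1,
      ∑ i, c i * ‖φ i z‖ ^ 2 = ‖f z‖ ^ 2 - ‖g z‖ ^ 2) :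
    ∀ z ∈ Metric.ball (0 : EuclideanSpace ℂ (Fin n)) 1, ‖f z‖ ^ 2 ≤ ‖g z‖ ^ 2 := by
  by_cases hneg : Fintype.card {i // c i < 0} < n
  · exact nonpos_of_few_neg c φ hφ hneg hf hg hu
  by_cases hpos : ∃ i, 0 < c i
  swap
  · push Not at hpos
    intro z hz
    have : ∑ i, c i * ‖φ i z‖ ^ 2 ≤ 0 := Finset.sum_nonpos fun i _ =>
      mul_nonpos_of_nonpos_of_nonneg (hpos i) (by positivity)
    rw [hu z hz] at this
    linarith
  exfalso
  obtain ⟨i₀, hi₀⟩ := hpos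
  have hcard : Fintype.card {i // ¬ c i < 0} ≤ 1 := by
    have := Fintype.card_subtype_compl (fun i => c i < 0)
    rw [Fintype.card_fin] at this
    omega
  have hother : ∀ i, i ≠ i₀ → c i < 0 := by
    intro i hi
    by_contra hc
    have := Fintype.card_le_one_iff.mp hcard ⟨i, hc⟩ ⟨i₀, by linarith⟩
    exact hi (congrArg Subtype.val this)
  have hcard2 : Fintype.card {i // (fun i => - c i) i < 0} < n := by
    have : Fintype.card {i // - c i < 0} ≤ Fintype.card {i // ¬ c i < 0} :=
      Fintype.card_subtype_mono _ _ fun i hi => by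
        have : - c i < 0 := hi
        change ¬ c i < 0
        linarith
    simp only
    omega
  have hge := nonpos_of_few_neg (fun i => - c i) φ hφ hcard2 hg hf (fun z hz => by
    simp only [neg_mul, Finset.sum_neg_distrib, hu z hz]; ring)
  have hzero : ∀ z ∈ Metric.ball (0 : EuclideanSpace ℂ (Fin n)) 1, φ i₀ z = 0 → h z = 0 := by
    intro z hz hz0
    have h1 : ∀ i, c i * ‖φ i z‖ ^ 2 ≤ 0 := by
      intro i
      by_cases hi : i = i₀
      · subst hi; simp [hz0]
      · exact mul_nonpos_of_nonpos_of_nonneg (hother i hi).le (by positivity)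
    have h2 : ∑ i, c i * ‖φ i z‖ ^ 2 = 0 := le_antisymm (Finset.sum_nonpos fun i _ => h1 i)
      (by rw [hu z hz]; linarith [hge z hz])
    have h3 := (Finset.sum_eq_zero_iff_of_nonpos fun i _ => h1 i).mp h2
    have h4 : ∀ i, φ i z = 0 := by
      intro i
      by_cases hi : i = i₀
      · subst hi; exact hz0
      · have := h3 i (Finset.mem_univ _)
        rcases mul_eq_zero.mp this with h | h
        · exact absurd h (hother i hi).ne
        · simpa using h
    have h5 := hhφ z
    simp only [h4] at h5
    simpa using h5
  have hφ0 : φ i₀ 0 = 0 := by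
    have h5 := hhφ 0
    rw [h0] at h5
    have h6 := (Finset.sum_eq_zero_iff_of_nonneg
      (fun i _ => sq_nonneg ‖φ i 0‖)).mp (by simpa using h5.symm) i₀ (Finset.mem_univ _)
    simpa using h6
  obtain ⟨r₀, hr₀, hb⟩ := proper_bound hh (1 / 2) (by norm_num)
  obtain ⟨r, hr, hr1⟩ := exists_between (max_lt hr₀ (zero_lt_one' ℝ))
  have hrpos : 0 < r := (le_max_right _ _).trans_lt hr
  have hball : Metric.sphere (0 : EuclideanSpace ℂ (Fin n)) r ⊆ Metric.ball 0 1 :=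
    Metric.sphere_subset_closedBall.trans (Metric.closedBall_subset_ball hr1)
  have hne : ∀ w ∈ Metric.sphere (0 : EuclideanSpace ℂ (Fin n)) r, 0 < ‖φ i₀ w‖ ^ 2 := by
    intro w hw
    have hwr : ‖w‖ = r := by simpa using hw
    have h1 := hb w (by rw [hwr]; exact (le_max_left _ _).trans_lt hr) (by rw [hwr]; exact hr1)
    have : φ i₀ w ≠ 0 := by
      intro h2
      rw [hzero w (hball hw) h2] at h1
      norm_num at h1
    positivity
  obtain ⟨δ, hδ, hδb⟩ : ∃ δ > 0, ∀ w ∈ Metric.sphere (0 : EuclideanSpace ℂ (Fin n)) r,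
      δ ≤ ‖φ i₀ w‖ ^ 2 := by
    have hcont : ContinuousOn (fun w => ‖φ i₀ w‖ ^ 2)
        (Metric.sphere (0 : EuclideanSpace ℂ (Fin n)) r) :=
      (((hφ i₀).continuousOn.mono hball).norm).pow 2
    rcases (Metric.sphere (0 : EuclideanSpace ℂ (Fin n)) r).eq_empty_or_nonempty with he | he
    · exact ⟨1, one_pos, by simp [he]⟩
    · obtain ⟨w, hw, hmin⟩ := (isCompact_sphere _ _).exists_isMinOn he hcont
      exact ⟨_, hne w hw, fun x hx => hmin hx⟩
  have hM : 0 < 2 / δ := by positivity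
  let c' : Option (Fin n) → ℝ := fun o => o.elim (-(2 / δ)) (fun _ => 1)
  let φ' : Option (Fin n) → EuclideanSpace ℂ (Fin n) → ℂ :=
    fun o => o.elim (φ i₀) (fun j z => z j)
  have hsum : ∀ z, ∑ o, c' o * ‖φ' o z‖ ^ 2 = -(2 / δ) * ‖φ i₀ z‖ ^ 2 + ‖z‖ ^ 2 := by
    intro z
    rw [Fintype.sum_option, EuclideanSpace.norm_sq_eq]
    simp [c', φ']
  have hdiff : ∀ o, DifferentiableOn ℂ (φ' o) (Metric.ball 0 1) := by
    intro o
    cases o with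
    | none => exact hφ i₀
    | some j =>
      have : Differentiable ℂ (fun z : EuclideanSpace ℂ (Fin n) => z j) := by fun_prop
      exact this.differentiableOn
  have hc' : Fintype.card {o // c' o < 0} < n := by
    have : Fintype.card {o // c' o < 0} ≤ 1 := by
      rw [Fintype.card_le_one_iff]
      rintro ⟨a, ha⟩ ⟨b, hb⟩
      cases a with
      | some j => simp [c'] at ha; linarith
      | none =>
        cases b with
        | some j => simp [c'] at hb; linarith
        | none => rfl
    omega
  have := max_principle c' φ' hdiff hc' r (-1) hr1 (fun w hw => ?_) 0 (by simpa using hrpos.le)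
  · rw [hsum, hφ0] at this
    norm_num at this
  · rw [hsum, hw]
    have h1 := hδb w (by simpa using hw)
    have h2 : 2 / δ * δ ≤ 2 / δ * ‖φ i₀ w‖ ^ 2 := mul_le_mul_of_nonneg_left h1 hM.le
    rw [div_mul_cancel₀ _ hδ.ne'] at h2
    nlinarith

section polar
variable {F : Type*} [NormedAddCommGroup F] [InnerProductSpace ℂ F] [CompleteSpace F]

lemma polar_deriv {a b : ℂ → F} {D : Set ℂ} (hD : IsOpen D) (ha : DifferentiableOn ℂ a D)
    (hb : DifferentiableOn ℂ b D) (hab : ∀ t ∈ D, inner ℂ (b t) (a t) = 0) :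
    ∀ t ∈ D, inner ℂ (b t) (deriv a t) = 0 := by
  intro t ht
  have h1 := (ha.differentiableAt (hD.mem_nhds ht)).hasDerivAt
  have h2 := (hb.differentiableAt (hD.mem_nhds ht)).hasDerivAt
  have key : ∀ v : ℂ, inner ℂ (b t) (v • deriv a t) + inner ℂ (v • deriv b t) (a t) = 0 := by
    intro v
    have hl : HasDerivAt (fun s : ℝ => t + (s : ℂ) * v) v 0 := by
      simpa using ((Complex.ofRealCLM.hasDerivAt (x := (0 : ℝ))).mul_const v).const_add t
    have ha' : HasDerivAt (fun s : ℝ => a (t + (s : ℂ) * v)) (v • deriv a t) 0 := by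
      have h1' : HasDerivAt a (deriv a t) (t + ((0 : ℝ) : ℂ) * v) := by simpa using h1
      exact h1'.scomp (0 : ℝ) hl
    have hb' : HasDerivAt (fun s : ℝ => b (t + (s : ℂ) * v)) (v • deriv b t) 0 := by
      have h2' : HasDerivAt b (deriv b t) (t + ((0 : ℝ) : ℂ) * v) := by simpa using h2
      exact h2'.scomp (0 : ℝ) hl
    have hi := hb'.inner ℂ ha'
    have hz : (fun s : ℝ => inner ℂ (b (t + (s : ℂ) * v)) (a (t + (s : ℂ) * v)))
        =ᶠ[𝓝 0] fun _ => 0 := by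
      have : Tendsto (fun s : ℝ => t + (s : ℂ) * v) (𝓝 0) (𝓝 t) := by
        simpa using hl.continuousAt.tendsto
      filter_upwards [this.eventually (hD.mem_nhds ht)] with s hs
      exact hab _ hs
    have := hi.unique ((hasDerivAt_const (0 : ℝ) (0 : ℂ)).congr_of_eventuallyEq hz)
    simpa only [Complex.ofReal_zero, zero_mul, add_zero] using this
  have k1 := key 1
  have k2 := key Complex.I
  simp only [inner_smul_left, inner_smul_right, one_smul, Complex.conj_I] at k1 k2
  have k3 : Complex.I * (2 * inner ℂ (b t) (deriv a t)) = 0 := by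
    linear_combination k2 + Complex.I * k1
  simpa using k3

lemma polar_iter {b : ℂ → F} {D : Set ℂ} (hD : IsOpen D) 
    (hb : DifferentiableOn ℂ b D) (k : ℕ) : ∀ {a : ℂ → F}, DifferentiableOn ℂ a D →
    (∀ t ∈ D, inner ℂ (b t) (a t) = 0) →
    ∀ t ∈ D, inner ℂ (b t) (iteratedDeriv k a t) = 0 := by
  induction k with
  | zero => intro a _ hab; simpa using hab
  | succ k ih =>
    intro a ha hab
    rw [iteratedDeriv_succ']
    exact ih (ha.deriv hD) (polar_deriv hD ha hb hab)

lemma polar {a b : ℂ → F} {D : Set ℂ} (hD : IsOpen D) (hDc : IsPreconnected D)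
    (ha : DifferentiableOn ℂ a D)
    (hb : DifferentiableOn ℂ b D) (hab : ∀ t ∈ D, inner ℂ (b t) (a t) = 0) :
    ∀ t ∈ D, ∀ s ∈ D, inner ℂ (b t) (a s) = 0 := by
  intro t ht s hs
  have hG : DifferentiableOn ℂ (fun s => inner ℂ (b t) (a s)) D :=
    (innerSL ℂ (b t)).differentiable.comp_differentiableOn ha
  have hev : (fun s => inner ℂ (b t) (a s)) =ᶠ[𝓝 t] 0 := by
    obtain ⟨ρ, hρ, hsub⟩ := Metric.isOpen_iff.mp hD t ht
    filter_upwards [Metric.ball_mem_nhds t hρ] with x hx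
    have h1 := Complex.hasSum_taylorSeries_on_ball (ha.mono hsub) hx
    have h2 := (innerSL ℂ (b t)).hasSum h1
    have h3 : ∀ k : ℕ, inner ℂ (b t) (iteratedDeriv k a t) = 0 :=
      fun k => polar_iter hD hb k ha hab t ht
    have h4 : (⇑(innerSL ℂ (b t)) ∘ fun n : ℕ => (n.factorial : ℂ)⁻¹ • (x - t) ^ n •
        iteratedDeriv n a t) = fun _ => 0 := by
      funext k
      simp [inner_smul_right, h3 k]
    have h5 := h2
    simp only [Function.comp_def] at h4 h5
    rw [h4] at h5
    exact h5.unique hasSum_zero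
  exact (hG.analyticOnNhd hD).eqOn_zero_of_preconnected_of_eventuallyEq_zero hDc ht hev hs

end polar

lemma polar_ball {n N : ℕ} {f g h : EuclideanSpace ℂ (Fin n) → EuclideanSpace ℂ (Fin N)}
    (hf : DifferentiableOn ℂ f (Metric.ball 0 1)) (hg : DifferentiableOn ℂ g (Metric.ball 0 1))
    (hh : DifferentiableOn ℂ h (Metric.ball 0 1))
    (H : ∀ z ∈ Metric.ball (0 : EuclideanSpace ℂ (Fin n)) 1,
      2 * ‖h z‖ ^ 2 = ‖f z‖ ^ 2 + ‖g z‖ ^ 2) :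
    ∀ z ∈ Metric.ball (0 : EuclideanSpace ℂ (Fin n)) 1,
    ∀ w ∈ Metric.ball (0 : EuclideanSpace ℂ (Fin n)) 1,
      2 * inner ℂ (h z) (h w) = inner ℂ (f z) (f w) + inner ℂ (g z) (g w) := by
  intro z hz w hw
  let l : ℂ → EuclideanSpace ℂ (Fin n) := fun t => z + t • (w - z)
  let D : Set ℂ := l ⁻¹' Metric.ball 0 1
  have hl : Differentiable ℂ l := by intro t; simp only [l]; fun_prop
  have hD : IsOpen D := Metric.isOpen_ball.preimage hl.continuous
  have hDc : IsPreconnected D := by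
    apply Convex.isPreconnected
    intro x hx y hy α β hα hβ hαβ
    have := convex_ball (0 : EuclideanSpace ℂ (Fin n)) 1 hx hy hα hβ hαβ
    change l _ ∈ Metric.ball (0 : EuclideanSpace ℂ (Fin n)) 1
    convert this using 1
    simp only [l]
    have hz' : z = α • z + β • z := by rw [← add_smul, hαβ, one_smul]
    have : (α • x + β • y) • (w - z) = α • (x • (w - z)) + β • (y • (w - z)) := by
      rw [add_smul, smul_assoc, smul_assoc]
    rw [this, smul_add, smul_add]
    nth_rewrite 1 [hz']
    abel
  have comp : ∀ {k : EuclideanSpace ℂ (Fin n) → EuclideanSpace ℂ (Fin N)},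
      DifferentiableOn ℂ k (Metric.ball 0 1) → DifferentiableOn ℂ (fun t => k (l t)) D :=
    fun hk => hk.comp hl.differentiableOn (fun _ ht => ht)
  let a : ℂ → PiLp 2 (fun _ : Fin 3 => EuclideanSpace ℂ (Fin N)) := fun t =>
    WithLp.toLp 2 ![h (l t), f (l t), g (l t)]
  let b : ℂ → PiLp 2 (fun _ : Fin 3 => EuclideanSpace ℂ (Fin N)) := fun t =>
    WithLp.toLp 2 ![(2 : ℂ) • h (l t), - f (l t), - g (l t)]
  have ha : DifferentiableOn ℂ a D := by
    rw [differentiableOn_piLp]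
    intro i
    fin_cases i
    · exact comp hh
    · exact comp hf
    · exact comp hg
  have hb : DifferentiableOn ℂ b D := by
    rw [differentiableOn_piLp]
    intro i
    fin_cases i
    · exact (comp hh).const_smul (2 : ℂ)
    · exact (comp hf).neg
    · exact (comp hg).neg
  have hin : ∀ t s, inner ℂ (b t) (a s) = 2 * inner ℂ (h (l t)) (h (l s))
      - inner ℂ (f (l t)) (f (l s)) - inner ℂ (g (l t)) (g (l s)) := by
    intro t s
    rw [PiLp.inner_apply, Fin.sum_univ_three]
    change inner ℂ ((2 : ℂ) • h (l t)) (h (l s)) + inner ℂ (- f (l t)) (f (l s))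
      + inner ℂ (- g (l t)) (g (l s)) = _
    rw [inner_smul_left, inner_neg_left, inner_neg_left, Complex.conj_ofNat]
    ring
  have := polar hD hDc ha hb (fun t ht => by
    rw [hin]
    simp only [inner_self_eq_norm_sq_to_K]
    have := H (l t) ht
    have h2 : (2 : ℂ) * (‖h (l t)‖ : ℂ) ^ 2 = (‖f (l t)‖ : ℂ) ^ 2 + (‖g (l t)‖ : ℂ) ^ 2 := by
      exact_mod_cast this
    simp only [Complex.coe_algebraMap]
    linear_combination h2) 0 (by simpa [D, l] using hz) 1 (by simpa [D, l] using hw)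
  rw [hin] at this
  simp only [l, zero_smul, add_zero, one_smul, add_sub_cancel] at this
  linear_combination this

lemma exists_factor {X V W : Type*} [AddCommGroup X] [Module ℂ X] [AddCommGroup V] [Module ℂ V]
    [AddCommGroup W] [Module ℂ W] (S : X →ₗ[ℂ] V) (T : X →ₗ[ℂ] W)
    (hker : ∀ x, S x = 0 → T x = 0) : ∃ L : V →ₗ[ℂ] W, ∀ x, T x = L (S x) := by
  obtain ⟨s, hs⟩ := S.rangeRestrict.exists_rightInverse_of_surjective S.range_rangeRestrict
  obtain ⟨L, hL⟩ := LinearMap.exists_extend (T ∘ₗ s)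
  refine ⟨L, fun x => ?_⟩
  have h1 : L (S x) = T (s (S.rangeRestrict x)) := by
    have := LinearMap.congr_fun hL (S.rangeRestrict x)
    simpa using this
  have h2 : S (s (S.rangeRestrict x)) = S x := by
    have := congrArg Subtype.val (LinearMap.congr_fun hs (S.rangeRestrict x))
    simpa using this
  rw [h1, ← sub_eq_zero, ← map_sub]
  exact hker _ (by rw [map_sub, h2, sub_self])

lemma exists_linear {Z V : Type*} [NormedAddCommGroup V] [InnerProductSpace ℂ V]
    (f g h : Z → V)
    (H : ∀ z w, 2 * inner ℂ (h z) (h w) = inner ℂ (f z) (f w) + inner ℂ (g z) (g w)) :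
    ∃ L : V →ₗ[ℂ] V, ∀ z, f z = L (h z) := by
  have hcomb : ∀ x : Z →₀ ℂ, 2 * inner ℂ (Finsupp.linearCombination ℂ h x)
      (Finsupp.linearCombination ℂ h x) = inner ℂ (Finsupp.linearCombination ℂ f x)
      (Finsupp.linearCombination ℂ f x) + inner ℂ (Finsupp.linearCombination ℂ g x)
      (Finsupp.linearCombination ℂ g x) := by
    intro x
    simp only [Finsupp.linearCombination_apply, Finsupp.sum, sum_inner, inner_sum,
      inner_smul_left, inner_smul_right, Finset.mul_sum]
    rw [← Finset.sum_add_distrib]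
    refine Finset.sum_congr rfl fun i _ => ?_
    rw [← Finset.sum_add_distrib]
    refine Finset.sum_congr rfl fun j _ => ?_
    first
      | linear_combination (starRingEnd ℂ (x i)) * x j * H i j
      | linear_combination (starRingEnd ℂ (x j)) * x i * H j i
  obtain ⟨L, hL⟩ := exists_factor (Finsupp.linearCombination ℂ h) (Finsupp.linearCombination ℂ f)
    (fun x hx => by
      have h1 := hcomb x
      rw [hx] at h1
      simp only [inner_self_eq_norm_sq_to_K, norm_zero, Complex.coe_algebraMap] at h1
      have h2 : (2 : ℝ) * 0 ^ 2 = ‖Finsupp.linearCombination ℂ f x‖ ^ 2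
        + ‖Finsupp.linearCombination ℂ g x‖ ^ 2 := by exact_mod_cast h1
      have h3 : ‖Finsupp.linearCombination ℂ f x‖ ^ 2 = 0 := by nlinarith
      simpa using h3)
  exact ⟨L, fun z => by simpa using hL (Finsupp.single z 1)⟩

lemma exists_diag {N : ℕ} (L K : EuclideanSpace ℂ (Fin N) →ₗ[ℂ] EuclideanSpace ℂ (Fin N)) :
    ∃ (c : Fin N → ℝ) (e : OrthonormalBasis (Fin N) ℂ (EuclideanSpace ℂ (Fin N))),
      ∀ v, ∑ i, c i * ‖inner ℂ (e i) v‖ ^ 2 = ‖L v‖ ^ 2 - ‖K v‖ ^ 2 := by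
  let T := LinearMap.adjoint L ∘ₗ L - LinearMap.adjoint K ∘ₗ K
  have hin : ∀ v w, inner ℂ (T v) w = inner ℂ (L v) (L w) - inner ℂ (K v) (K w) := by
    intro v w
    simp [T, inner_sub_left, LinearMap.adjoint_inner_left]
  have hin' : ∀ v w, inner ℂ v (T w) = inner ℂ (L v) (L w) - inner ℂ (K v) (K w) := by
    intro v w
    simp [T, inner_sub_right, LinearMap.adjoint_inner_right]
  have hT : T.IsSymmetric := fun v w => by rw [hin, hin']
  have hfr : Module.finrank ℂ (EuclideanSpace ℂ (Fin N)) = N := by simp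
  refine ⟨hT.eigenvalues hfr, hT.eigenvectorBasis hfr, fun v => ?_⟩
  have h1 := (hT.eigenvectorBasis hfr).sum_inner_mul_inner (T v) v
  have h2 : ∀ i, inner ℂ (T v) (hT.eigenvectorBasis hfr i) *
      inner ℂ (hT.eigenvectorBasis hfr i) v
      = ((hT.eigenvalues hfr i * ‖inner ℂ (hT.eigenvectorBasis hfr i) v‖ ^ 2 : ℝ) : ℂ) := by
    intro i
    rw [hT v, hT.apply_eigenvectorBasis, inner_smul_right, mul_assoc,
      ← inner_conj_symm v, Complex.conj_mul']
    push_cast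
    rfl
  simp only [h2] at h1
  rw [hin] at h1
  simp only [inner_self_eq_norm_sq_to_K, Complex.coe_algebraMap] at h1
  exact_mod_cast h1

/-- For `n ≥ 2`, there is no positive-dimensional convex family of origin-preserving
proper holomorphic maps from `B_n` to `B_N` with `N ≤ n + 1`. -/
theorem no_convex_family_in_low_codimension
    (n N : ℕ) (hn : 2 ≤ n) (hN : N ≤ n + 1)
    (f g : EuclideanSpace ℂ (Fin n) → EuclideanSpace ℂ (Fin N))
    (hf : IsProperBallMap n N f) (hg : IsProperBallMap n N g)
    (hf0 : f 0 = 0) (hg0 : g 0 = 0)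
    (H : ∀ lam : ℝ, lam ∈ Set.Icc (0 : ℝ) 1 →
      ∃ h : EuclideanSpace ℂ (Fin n) → EuclideanSpace ℂ (Fin N),
        IsProperBallMap n N h ∧
        ∀ z ∈ Metric.ball (0 : EuclideanSpace ℂ (Fin n)) 1,
          ‖h z‖ ^ 2 = lam * ‖f z‖ ^ 2 + (1 - lam) * ‖g z‖ ^ 2) :
    ∀ z ∈ Metric.ball (0 : EuclideanSpace ℂ (Fin n)) 1, ‖f z‖ ^ 2 = ‖g z‖ ^ 2 := by
  obtain ⟨h, hh, hH⟩ := H (1 / 2) (by norm_num)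
  have hH2 : ∀ z ∈ Metric.ball (0 : EuclideanSpace ℂ (Fin n)) 1,
      2 * ‖h z‖ ^ 2 = ‖f z‖ ^ 2 + ‖g z‖ ^ 2 := by
    intro z hz
    rw [hH z hz]; ring
  have h0 : h 0 = 0 := by
    have := hH2 0 (by simp)
    rw [hf0, hg0] at this
    simpa using this
  have hpol := polar_ball hf.1 hg.1 hh.1 hH2
  let Z := Metric.ball (0 : EuclideanSpace ℂ (Fin n)) 1
  obtain ⟨L, hL⟩ := exists_linear (fun z : Z => f z) (fun z : Z => g z) (fun z : Z => h z)
    (fun z w => hpol z z.2 w w.2)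
  obtain ⟨K, hK⟩ := exists_linear (fun z : Z => g z) (fun z : Z => f z) (fun z : Z => h z)
    (fun z w => by rw [hpol z z.2 w w.2, add_comm])
  obtain ⟨c, e, hce⟩ := exists_diag L K
  have hu : ∀ z ∈ Metric.ball (0 : EuclideanSpace ℂ (Fin n)) 1,
      ∑ i, c i * ‖inner ℂ (e i) (h z)‖ ^ 2 = ‖f z‖ ^ 2 - ‖g z‖ ^ 2 := by
    intro z hz
    have h1 : f z = L (h z) := hL ⟨z, hz⟩
    have h2 : g z = K (h z) := hK ⟨z, hz⟩
    rw [hce, h1, h2]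
  have hφ : ∀ i, DifferentiableOn ℂ (fun z => inner ℂ (e i) (h z)) (Metric.ball 0 1) :=
    fun i => (innerSL ℂ (e i)).differentiable.comp_differentiableOn hh.1
  have hn2 : ∀ z, ‖h z‖ ^ 2 = ∑ i, ‖inner ℂ (e i) (h z)‖ ^ 2 := fun z =>
    (e.sum_sq_norm_inner_right (h z)).symm
  intro z hz
  refine le_antisymm ?_ ?_
  · exact half hn hN c _ hφ hf hg hh h0 hn2 hu z hz
  · exact half hn hN (fun i => - c i) _ hφ hg hf hh h0 hn2 (fun z hz => by
      simp only [neg_mul, Finset.sum_neg_distrib, hu z hz]; ring) z hz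
end

section
/- Fix N ≥ 2 and a real number C, and suppose that every rational proper map from B_2 to B_N in lowest terms has degree at most C. Then for every n ≥ 2, every rational proper map from B_n to B_N in lowest terms, of degree d, satisfies d ≤ C/(2n−3). -/
open MvPolynomial

/-- `p/q` is a rational proper map from `B_n` to `B_N` in lowest terms:
`q` does not vanish on the closed ball, no nonconstant polynomial divides `q` and
all the `p_i`, `‖p(z)‖ < |q(z)|` on the open ball, and `‖p(z)‖ = |q(z)|` on the sphere. -/
def IsRationalProperBallMap (n N : ℕ) (p : Fin N → MvPolynomial (Fin n) ℂ)
    (q : MvPolynomial (Fin n) ℂ) : Prop :=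
  (∀ z : EuclideanSpace ℂ (Fin n), ‖z‖ ≤ 1 → eval (fun i => z i) q ≠ 0) ∧
  (∀ r : MvPolynomial (Fin n) ℂ, r ∣ q → (∀ i, r ∣ p i) → r.totalDegree = 0) ∧
  (∀ z : EuclideanSpace ℂ (Fin n), ‖z‖ < 1 →
    ∑ i, ‖eval (fun j => z j) (p i)‖ ^ 2 < ‖eval (fun j => z j) q‖ ^ 2) ∧
  (∀ z : EuclideanSpace ℂ (Fin n), ‖z‖ = 1 →
    ∑ i, ‖eval (fun j => z j) (p i)‖ ^ 2 = ‖eval (fun j => z j) q‖ ^ 2)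

/-- The degree of a rational map `p/q`: the maximum of the degrees of the
components of the numerator and of the denominator. -/
def rationalDegree (n N : ℕ) (p : Fin N → MvPolynomial (Fin n) ℂ)
    (q : MvPolynomial (Fin n) ℂ) : ℕ :=
  max (Finset.univ.sup fun i => (p i).totalDegree) q.totalDegree


theorem natDegree_zero_bezout {R : Type*} [CommRing R] [IsDomain R] [UniqueFactorizationMonoid R]
    {ι : Type*} [Fintype ι] (f : ι → Polynomial R) (i0 : ι) (h0 : f i0 ≠ 0)
    (hf : ∀ D : Polynomial R, (∀ i, D ∣ f i) → D.natDegree = 0) :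
    ∃ (c : R) (A : ι → Polynomial R), c ≠ 0 ∧ ∑ i, A i * f i = Polynomial.C c := by
  classical
  let : NormalizedGCDMonoid R := Classical.arbitrary _
  let K := FractionRing R
  let φ := algebraMap R K
  have hφ : Function.Injective φ := IsFractionRing.injective R K
  let I : Ideal (Polynomial K) := Ideal.span (Set.range fun i => (f i).map φ)
  obtain ⟨D, hD⟩ : ∃ D, I = Ideal.span {D} := (IsPrincipalIdealRing.principal I).principal
  have hdvd : ∀ i, D ∣ (f i).map φ := by
    intro i
    rw [← Ideal.mem_span_singleton, ← hD]
    exact Ideal.subset_span ⟨i, rfl⟩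
  have hD0 : D ≠ 0 := by
    rintro rfl
    have := zero_dvd_iff.mp (hdvd i0)
    exact h0 ((Polynomial.map_eq_zero_iff hφ).mp this)
  let E := IsLocalization.integerNormalization (nonZeroDivisors R) D
  obtain ⟨b, hbm, hb⟩ := IsLocalization.integerNormalization_spec (nonZeroDivisors R) D
  have hb0 : φ b ≠ 0 := fun h => nonZeroDivisors.ne_zero hbm (hφ (by simpa using h))
  have hb' : E.map φ = Polynomial.C (φ b) * D := by
    rw [← Polynomial.smul_eq_C_mul]
    simpa [E, φ, algebraMap_smul] using hb
  have hE0 : E ≠ 0 := by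
    intro h
    rw [h, Polynomial.map_zero] at hb'
    exact mul_ne_zero (Polynomial.C_ne_zero.mpr hb0) hD0 hb'.symm
  have hE : ∀ i, E.primPart ∣ f i := by
    intro i
    apply E.isPrimitive_primPart.dvd_of_fraction_map_dvd_fraction_map (K := K)
    refine dvd_trans ?_ (hdvd i)
    have h1 : E.primPart.map φ ∣ Polynomial.C (φ b) * D := by
      rw [← hb']
      exact Polynomial.map_dvd φ ⟨Polynomial.C E.content, by
        rw [mul_comm]; exact E.eq_C_content_mul_primPart⟩
    have hu : IsUnit (Polynomial.C (φ b)) := Polynomial.isUnit_C.mpr (isUnit_iff_ne_zero.mpr hb0)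
    exact (hu.dvd_mul_left).mp h1
  have hdeg := hf _ hE
  rw [Polynomial.natDegree_primPart, ← Polynomial.natDegree_map_eq_of_injective hφ, hb',
    Polynomial.natDegree_C_mul hb0] at hdeg
  have hDu : IsUnit D := by
    rw [Polynomial.isUnit_iff_degree_eq_zero, Polynomial.degree_eq_natDegree hD0, hdeg]; rfl
  have h1 : (1 : Polynomial K) ∈ I := by
    rw [hD, Ideal.span_singleton_eq_top.mpr hDu]; trivial
  obtain ⟨g, hg⟩ := Ideal.mem_span_range_iff_exists_fun.mp h1
  choose B hBm hB using fun i => IsLocalization.integerNormalization_spec (nonZeroDivisors R) (g i)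
  refine ⟨∏ i, (B i : R), fun i => Polynomial.C (∏ j ∈ Finset.univ.erase i, (B j : R)) *
    IsLocalization.integerNormalization (nonZeroDivisors R) (g i), ?_, ?_⟩
  · exact Finset.prod_ne_zero_iff.mpr fun i _ => nonZeroDivisors.ne_zero (hBm i)
  · apply Polynomial.map_injective φ hφ
    have : ∀ i, (IsLocalization.integerNormalization (nonZeroDivisors R) (g i)).map φ
        = Polynomial.C (φ (B i)) * g i := by
      intro i
      rw [← Polynomial.smul_eq_C_mul]
      simpa [φ, algebraMap_smul] using hB i
    rw [Polynomial.map_sum]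
    simp only [Polynomial.map_mul, this, Polynomial.map_C]
    rw [← mul_one (Polynomial.C (φ (∏ i, (B i : R)))), ← hg, Finset.mul_sum]
    refine Finset.sum_congr rfl fun i _ => ?_
    rw [← Finset.mul_prod_erase Finset.univ (fun i => (B i : R)) (Finset.mem_univ i)]
    simp only [map_mul]
    ring

noncomputable def lineRes {n : ℕ} (a : Fin n → ℂ) : MvPolynomial (Fin n) ℂ →ₐ[ℂ] Polynomial ℂ :=
  aeval (fun i => Polynomial.C (a i) * Polynomial.X)

noncomputable def lineGen (n : ℕ) :
    MvPolynomial (Fin n) ℂ →ₐ[ℂ] Polynomial (MvPolynomial (Fin n) ℂ) :=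
  aeval (fun i => Polynomial.C (X i) * Polynomial.X)

theorem lineGen_map {n : ℕ} (a : Fin n → ℂ) (P : MvPolynomial (Fin n) ℂ) :
    (lineGen n P).map (eval a) = lineRes a P := by
  induction P using MvPolynomial.induction_on with
  | C c => 
    simp only [lineGen, lineRes, algHom_C, Polynomial.algebraMap_apply, Polynomial.map_C,
      algebraMap_eq, eval_C, Algebra.algebraMap_self, RingHom.id_apply]
  | add p q hp hq => simp [hp, hq]
  | mul_X p i hp => 
    rw [map_mul, Polynomial.map_mul, hp, map_mul]
    simp [lineGen, lineRes]

theorem lineRes_coeff {n : ℕ} (a : Fin n → ℂ) (P : MvPolynomial (Fin n) ℂ) (d : ℕ) :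
    (lineRes a P).coeff d = eval a (homogeneousComponent d P) := by
  induction P using MvPolynomial.induction_on' with
  | monomial e c =>
    have h1 : lineRes a (monomial e c) = Polynomial.C (eval a (monomial e c)) * Polynomial.X ^ e.degree := by
      rw [lineRes, aeval_monomial, eval_monomial]
      simp only [Finsupp.prod, mul_pow, Finset.prod_mul_distrib, Finset.prod_pow_eq_pow_sum,
        map_mul, map_prod, map_pow, Finsupp.degree, ← Polynomial.C_eq_algebraMap, mul_assoc]
      rfl
    rw [h1, Polynomial.coeff_C_mul_X_pow]
    have h2 : (monomial e c).IsHomogeneous e.degree := isHomogeneous_monomial _ rfl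
    rw [homogeneousComponent_of_mem (m := d) (n := e.degree) h2]
    split_ifs <;> simp_all
  | add p q hp hq => simp [hp, hq]

theorem eval_zero_lineRes {n : ℕ} (a : Fin n → ℂ) (P : MvPolynomial (Fin n) ℂ) (s : ℂ) :
    (lineRes a P).eval s = eval (fun i => a i * s) P := by
  rw [lineRes, ← Polynomial.coe_aeval_eq_eval, ← AlgHom.comp_apply, comp_aeval]
  simp [aeval_eq_eval]

/-- `s ↦ σ`, `x ↦ σ⁻¹ x` -/
noncomputable def backHom (n : ℕ) (σ : ℂ) :
    Polynomial (MvPolynomial (Fin n) ℂ) →+* MvPolynomial (Fin n) ℂ :=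
  Polynomial.eval₂RingHom (aeval (fun i => C σ⁻¹ * X i) : MvPolynomial (Fin n) ℂ →ₐ[ℂ] MvPolynomial (Fin n) ℂ).toRingHom
    (C σ)

theorem backHom_lineGen {n : ℕ} {σ : ℂ} (hσ : σ ≠ 0) (P : MvPolynomial (Fin n) ℂ) :
    backHom n σ (lineGen n P) = P := by
  induction P using MvPolynomial.induction_on with
  | C c => 
    simp [lineGen, backHom, algHom_C, Polynomial.algebraMap_apply, algebraMap_eq]
  | add p q hp hq => simp [hp, hq]
  | mul_X p i hp => 
    rw [map_mul, map_mul, hp]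
    simp only [lineGen, backHom, aeval_X, map_mul, Polynomial.coe_eval₂RingHom, Polynomial.eval₂_C,
      Polynomial.eval₂_X, AlgHom.toRingHom_eq_coe, RingHom.coe_coe]
    rw [mul_right_comm, ← C_mul, inv_mul_cancel₀ hσ, C_1, one_mul]

theorem eval_backHom {n : ℕ} (σ : ℂ) (x : Fin n → ℂ) (D : Polynomial (MvPolynomial (Fin n) ℂ)) :
    eval x (backHom n σ D) = (D.map (eval fun i => σ⁻¹ * x i)).eval σ := by
  induction D using Polynomial.induction_on' with
  | add p q hp hq => simp [hp, hq]
  | monomial k c =>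
    have : eval x ((bind₁ fun i => C σ⁻¹ * X i) c) = eval (fun i => σ⁻¹ * x i) c := by
      induction c using MvPolynomial.induction_on with
      | C c => simp [algHom_C]
      | add p q hp hq => simp [hp, hq]
      | mul_X p i hp => simp [hp]
    simp [backHom, this]

theorem natDegree_lineGen_dvd {n : ℕ} {ι : Type*}
    (f : ι → MvPolynomial (Fin n) ℂ) (i0 : ι) (h0 : eval 0 (f i0) ≠ 0)
    (hf : ∀ r, (∀ i, r ∣ f i) → r.totalDegree = 0)
    (D : Polynomial (MvPolynomial (Fin n) ℂ)) (hD : ∀ i, D ∣ lineGen n (f i)) :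
    D.natDegree = 0 := by
  have h1 : ∀ σ : ℂ, σ ≠ 0 → ∀ x : Fin n → ℂ,
      (D.map (eval x)).eval σ = (D.map (eval 0)).eval σ := by
    intro σ hσ x
    have h2 := hf (backHom n σ D) fun i => by
      rw [← backHom_lineGen hσ (f i)]
      exact map_dvd _ (hD i)
    rw [totalDegree_eq_zero_iff_eq_C] at h2
    have h3 := eval_backHom σ (fun i => σ * x i) D
    have h4 := eval_backHom σ 0 D
    rw [h2, eval_C] at h3 h4
    have e1 : (fun i => σ⁻¹ * (σ * x i)) = x := by ext i; field_simp
    have e2 : (fun i => σ⁻¹ * (0 : Fin n → ℂ) i) = 0 := by ext i; simp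
    rw [e1] at h3
    rw [e2] at h4
    rw [← h3, ← h4]
  obtain ⟨c, hc⟩ : ∃ c, D.map (eval 0) = Polynomial.C c := by
    have h2 : D.map (eval 0) ∣ Polynomial.C (eval 0 (f i0)) := by
      have h3 := Polynomial.map_dvd (eval (0 : Fin n → ℂ)) (hD i0)
      rw [lineGen_map] at h3
      convert h3 using 1
      apply Polynomial.funext
      intro s
      rw [eval_zero_lineRes, Polynomial.eval_C]
      congr 2
      ext i; simp
    have h3 : IsUnit (D.map (eval 0)) := isUnit_of_dvd_unit h2
      (Polynomial.isUnit_C.mpr (isUnit_iff_ne_zero.mpr h0))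
    obtain ⟨c, -, hc⟩ := Polynomial.isUnit_iff.mp h3
    exact ⟨c, hc.symm⟩
  have h2 : ∀ x, D.map (eval x) = Polynomial.C c := by
    intro x
    apply Polynomial.eq_of_infinite_eval_eq
    refine Set.Infinite.mono (s := {0}ᶜ) ?_ (Set.finite_singleton (0 : ℂ)).infinite_compl
    intro σ hσ
    rw [Set.mem_ofPred_eq, h1 σ hσ x, hc]
  rw [Polynomial.natDegree_eq_zero]
  refine ⟨D.coeff 0, ?_⟩
  ext1 k
  rw [Polynomial.coeff_C]
  split_ifs with hk
  · rw [hk]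
  · apply MvPolynomial.funext
    intro x
    have := congrArg (fun p => Polynomial.coeff p k) (h2 x)
    simp only [Polynomial.coeff_map, Polynomial.coeff_C, if_neg hk] at this
    rw [this, map_zero]

theorem homogComp_ne_zero {n : ℕ} {P : MvPolynomial (Fin n) ℂ} (hP : P ≠ 0) :
    homogeneousComponent P.totalDegree P ≠ 0 := by
  obtain ⟨e, he, h⟩ := Finset.exists_mem_eq_sup P.support (support_nonempty.mpr hP) 
    (fun s => s.sum fun _ e => e)
  intro h0
  have := congrArg (coeff e) h0
  rw [coeff_homogeneousComponent, if_pos, coeff_zero] at this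
  · exact mem_support_iff.mp he this
  · rw [totalDegree, h]; rfl

theorem generic_line {n : ℕ} (k0 : Fin n) {ι : Type*} [Fintype ι]
    (f : ι → MvPolynomial (Fin n) ℂ) (i0 : ι) (h0 : eval 0 (f i0) ≠ 0)
    (hf : ∀ r, (∀ i, r ∣ f i) → r.totalDegree = 0) (j : ι) :
    ∃ a : Fin n → ℂ, a ≠ 0 ∧ 
      (∃ A : ι → Polynomial ℂ, ∑ i, A i * lineRes a (f i) = 1) ∧
      (f j).totalDegree ≤ (lineRes a (f j)).natDegree := by
  obtain ⟨c, A, hc, hA⟩ := natDegree_zero_bezout (fun i => lineGen n (f i)) i0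
    (by
      intro h
      have := backHom_lineGen one_ne_zero (f i0)
      rw [h, map_zero] at this
      rw [← this, map_zero] at h0
      exact h0 rfl)
    (natDegree_lineGen_dvd f i0 h0 hf)
  let T := if f j = 0 then 1 else homogeneousComponent (f j).totalDegree (f j)
  have hT : T ≠ 0 := by
    simp only [T]
    split_ifs with h
    · exact one_ne_zero
    · exact homogComp_ne_zero h
  obtain ⟨a, ha⟩ : ∃ a, eval a (c * T * X k0) ≠ 0 := by
    by_contra! h
    exact mul_ne_zero (mul_ne_zero hc hT) (X_ne_zero k0) 
      (MvPolynomial.funext fun a => by rw [h a, map_zero])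
  rw [map_mul, map_mul, eval_X] at ha
  have ha1 := left_ne_zero_of_mul (left_ne_zero_of_mul ha)
  have ha2 := right_ne_zero_of_mul (left_ne_zero_of_mul ha)
  have ha3 := right_ne_zero_of_mul ha
  refine ⟨a, fun h => ha3 (by rw [h]; rfl), 
    ⟨fun i => Polynomial.C (eval a c)⁻¹ * (A i).map (eval a), ?_⟩, ?_⟩
  · have h1 := congrArg (Polynomial.map (eval a)) hA
    rw [Polynomial.map_sum, Polynomial.map_C] at h1
    simp only [Polynomial.map_mul, lineGen_map] at h1
    simp only [mul_assoc]
    rw [← Finset.mul_sum, h1, ← Polynomial.C_mul, inv_mul_cancel₀ ha1, Polynomial.C_1]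
  · by_cases h : f j = 0
    · simp [h]
    · apply Polynomial.le_natDegree_of_ne_zero
      rw [lineRes_coeff]
      simpa [T, h] using ha2

noncomputable def lucasC : ℕ → ℕ → ℝ
  | 0, k => if k = 0 then 2 else 0
  | 1, k => if k = 0 then 1 else 0
  | m + 2, 0 => lucasC (m + 1) 0
  | m + 2, k + 1 => lucasC (m + 1) (k + 1) + lucasC m k

theorem lucasC_nonneg (m : ℕ) : ∀ k, 0 ≤ lucasC m k := by
  induction m using Nat.twoStepInduction with
  | zero => intro k; rw [lucasC]; split_ifs <;> norm_num
  | one => intro k; rw [lucasC]; split_ifs <;> norm_num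
  | more m ih1 ih2 =>
    intro k
    cases k with
    | zero => rw [lucasC]; exact ih2 0
    | succ k => rw [lucasC]; exact add_nonneg (ih2 _) (ih1 _)

theorem lucasC_zero (m : ℕ) : lucasC (m + 1) 0 = 1 := by
  induction m with
  | zero => simp [lucasC]
  | succ m ih => rw [lucasC, ih]

theorem lucasC_eq_zero (m : ℕ) : ∀ k, m < 2 * k → lucasC m k = 0 := by
  induction m using Nat.twoStepInduction with
  | zero => intro k h; rw [lucasC, if_neg (by omega)]
  | one => intro k h; rw [lucasC, if_neg (by omega)]
  | more m ih1 ih2 =>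
    intro k h
    cases k with
    | zero => omega
    | succ k => rw [lucasC, ih1 _ (by omega), ih2 _ (by omega), add_zero]

theorem lucas_sum (x y : ℝ) (hxy : x + y = 1) (m : ℕ) : ∀ M, m < 2 * M →
    ∑ k ∈ Finset.range M, lucasC m k * x ^ (m - 2 * k) * y ^ k = 1 + (-y) ^ m := by
  induction m using Nat.twoStepInduction with
  | zero =>
    intro M hM
    obtain ⟨M, rfl⟩ : ∃ M', M = M' + 1 := ⟨M - 1, by omega⟩
    rw [Finset.sum_range_succ']
    simp [lucasC]; norm_num
  | one =>
    intro M hM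
    obtain ⟨M, rfl⟩ : ∃ M', M = M' + 1 := ⟨M - 1, by omega⟩
    rw [Finset.sum_range_succ']
    simp [lucasC]; linarith
  | more m ih1 ih2 =>
    intro M hM
    obtain ⟨M, rfl⟩ : ∃ M', M = M' + 1 := ⟨M - 1, by omega⟩
    have h1 := ih1 M (by omega)
    have h2 := ih2 (M + 1) (by omega)
    have e : 1 + (-y) ^ (m + 2) = x * (1 + (-y) ^ (m + 1)) + y * (1 + (-y) ^ m) := by
      have : x = 1 - y := by linarith
      rw [this]; ring
    rw [e, ← h1, ← h2, Finset.sum_range_succ', Finset.sum_range_succ', mul_add, Finset.mul_sum,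
      Finset.mul_sum, add_right_comm, ← Finset.sum_add_distrib]
    congr 1
    · refine Finset.sum_congr rfl fun k _ => ?_
      rw [lucasC]
      have e1 : m + 2 - 2 * (k + 1) = m - 2 * k := by omega
      rw [e1]
      by_cases hk : m + 1 < 2 * (k + 1)
      · rw [lucasC_eq_zero _ _ hk]; ring
      · have e2 : m - 2 * k = (m + 1 - 2 * (k + 1)) + 1 := by omega
        rw [e2]; ring
    · rw [lucasC]
      simp only [mul_zero, Nat.sub_zero]
      ring

noncomputable def sharpMap (r : ℕ) (j : Fin (r + 2)) : MvPolynomial (Fin 2) ℂ :=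
  if (j : ℕ) < r + 1 then
    C ((Real.sqrt (lucasC (2 * r + 1) j) : ℝ) : ℂ) * X 0 ^ (2 * r + 1 - 2 * (j : ℕ)) * X 1 ^ (j : ℕ)
  else X 1 ^ (2 * r + 1)

theorem sharpMap_norm (r : ℕ) (z : Fin 2 → ℂ) :
    ∑ j, ‖eval z (sharpMap r j)‖ ^ 2 =
      ∑ k ∈ Finset.range (r + 1), lucasC (2 * r + 1) k * (‖z 0‖ ^ 2) ^ (2 * r + 1 - 2 * k)
        * (‖z 1‖ ^ 2) ^ k + (‖z 1‖ ^ 2) ^ (2 * r + 1) := by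
  rw [Fin.sum_univ_castSucc, Finset.sum_range]
  congr 1
  · refine Finset.sum_congr rfl fun j _ => ?_
    have : ((Fin.castSucc j : Fin (r + 2)) : ℕ) < r + 1 := by simpa using j.is_le
    rw [sharpMap, if_pos this]
    simp only [map_mul, map_pow, eval_C, eval_X, norm_mul, norm_pow, mul_pow, Fin.val_castSucc,
      Complex.norm_real, Real.norm_eq_abs, sq_abs, Real.sq_sqrt (lucasC_nonneg _ _)]
    ring
  · have : ¬ ((Fin.last (r + 1) : Fin (r + 2)) : ℕ) < r + 1 := by simp
    rw [sharpMap, if_neg this]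
    simp only [map_pow, eval_X, norm_pow]
    ring

theorem sharpMap_sphere (r : ℕ) (z : Fin 2 → ℂ) (hz : ‖z 0‖ ^ 2 + ‖z 1‖ ^ 2 = 1) :
    ∑ j, ‖eval z (sharpMap r j)‖ ^ 2 = 1 := by
  rw [sharpMap_norm, lucas_sum _ _ hz _ _ (by omega), Odd.neg_pow ⟨r, rfl⟩]
  ring

theorem sharpMap_ball (r : ℕ) (z : Fin 2 → ℂ) (hz : ‖z 0‖ ^ 2 + ‖z 1‖ ^ 2 < 1) :
    ∑ j, ‖eval z (sharpMap r j)‖ ^ 2 < 1 := by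
  rw [sharpMap_norm]
  set x := ‖z 0‖ ^ 2
  set y := ‖z 1‖ ^ 2
  have hx : 0 ≤ x := by positivity
  have hy : 0 ≤ y := by positivity
  have h := lucas_sum x (1 - x) (by ring) (2 * r + 1) (r + 1) (by omega)
  rw [Odd.neg_pow ⟨r, rfl⟩] at h
  have h1 : ∑ k ∈ Finset.range (r + 1), lucasC (2 * r + 1) k * x ^ (2 * r + 1 - 2 * k) * y ^ k ≤
      ∑ k ∈ Finset.range (r + 1), lucasC (2 * r + 1) k * x ^ (2 * r + 1 - 2 * k) * (1 - x) ^ k := by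
    refine Finset.sum_le_sum fun k _ => ?_
    have := lucasC_nonneg (2 * r + 1) k
    gcongr
    linarith
  have h2 : y ^ (2 * r + 1) < (1 - x) ^ (2 * r + 1) := by
    apply pow_lt_pow_left₀ (by linarith) hy (by omega)
  linarith

/-- restriction to the first axis -/
noncomputable def axisRes : MvPolynomial (Fin 2) ℂ →ₐ[ℂ] Polynomial ℂ :=
  aeval ![Polynomial.X, 0]

theorem axisRes_natDegree_le (P : MvPolynomial (Fin 2) ℂ) :
    (axisRes P).natDegree ≤ P.totalDegree := by
  have := aeval_natDegree_le (n := 1) P le_rfl ![Polynomial.X, 0] (by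
    intro i; fin_cases i <;> simp)
  simpa [axisRes] using this

theorem axisRes_sharpMap (r : ℕ) (j : Fin (r + 2)) :
    axisRes (sharpMap r j) = if j = 0 then Polynomial.X ^ (2 * r + 1) else 0 := by
  have hX0 : axisRes (X 0) = Polynomial.X := by simp [axisRes]
  have hX1 : axisRes (X 1) = 0 := by simp [axisRes]
  rw [sharpMap]
  by_cases hj : j = 0
  · subst hj
    rw [if_pos (by simp), if_pos rfl, Fin.val_zero, lucasC_zero]
    simp [hX0]
  · have hj' : (j : ℕ) ≠ 0 := fun h => hj (Fin.ext h)
    rw [if_neg hj]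
    split_ifs <;> simp [hX1, hj']

theorem exists_max_common_dvd {N : ℕ} (p : Fin N → MvPolynomial (Fin 2) ℂ)
    (q : MvPolynomial (Fin 2) ℂ) (hq : q ≠ 0) :
    ∃ (h : MvPolynomial (Fin 2) ℂ) (p' : Fin N → MvPolynomial (Fin 2) ℂ)
      (q' : MvPolynomial (Fin 2) ℂ), (∀ i, p i = h * p' i) ∧ q = h * q' ∧
      ∀ r : MvPolynomial (Fin 2) ℂ, r ∣ q' → (∀ i, r ∣ p' i) → r.totalDegree = 0 := by
  classical
  let S : Set ℕ := {k | ∃ h : MvPolynomial (Fin 2) ℂ, h ∣ q ∧ (∀ i, h ∣ p i) ∧ h.totalDegree = k}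
  have hdeg : ∀ h u : MvPolynomial (Fin 2) ℂ, h * u ≠ 0 →
      (h * u).totalDegree = h.totalDegree + u.totalDegree := fun h u hu =>
    totalDegree_mul_of_isDomain (left_ne_zero_of_mul hu) (right_ne_zero_of_mul hu)
  have hb : BddAbove S := by
    refine ⟨q.totalDegree, ?_⟩
    rintro k ⟨h, ⟨u, rfl⟩, -, rfl⟩
    rw [hdeg h u hq]; omega
  have hne : S.Nonempty := ⟨_, 1, one_dvd _, fun _ => one_dvd _, rfl⟩
  obtain ⟨h, ⟨q', hq'⟩, hp, hk⟩ := Nat.sSup_mem hne hb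
  choose p' hp' using hp
  refine ⟨h, p', q', hp', hq', ?_⟩
  intro r hrq hrp
  have hr0 : h * r ≠ 0 := by
    obtain ⟨u, rfl⟩ := hrq
    rw [hq', ← mul_assoc] at hq
    exact left_ne_zero_of_mul hq
  have hmem : (h * r).totalDegree ∈ S := ⟨h * r, hq' ▸ mul_dvd_mul_left h hrq,
    fun i => hp' i ▸ mul_dvd_mul_left h (hrp i), rfl⟩
  have := le_csSup hb hmem
  rw [hdeg h r hr0] at this
  omega

theorem exists_degree_member (n N : ℕ) (p : Fin N → MvPolynomial (Fin n) ℂ)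
    (q : MvPolynomial (Fin n) ℂ) :
    ∃ j : Option (Fin N), (j.elim q p).totalDegree = rationalDegree n N p q := by
  unfold rationalDegree
  rcases le_total (Finset.univ.sup fun i => (p i).totalDegree) q.totalDegree with h | h
  · exact ⟨none, by rw [max_eq_right h]; rfl⟩
  · rw [max_eq_left h]
    by_cases hN : (Finset.univ : Finset (Fin N)).Nonempty
    · obtain ⟨i, -, hi⟩ := Finset.exists_mem_eq_sup Finset.univ hN (fun i => (p i).totalDegree)
      exact ⟨some i, hi.symm⟩
    · rw [Finset.not_nonempty_iff_eq_empty] at hN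
      rw [hN] at h ⊢
      refine ⟨none, ?_⟩
      simpa using h

theorem le_rationalDegree (n N : ℕ) (p : Fin N → MvPolynomial (Fin n) ℂ)
    (q : MvPolynomial (Fin n) ℂ) (j : Option (Fin N)) :
    (j.elim q p).totalDegree ≤ rationalDegree n N p q := by
  unfold rationalDegree
  cases j with
  | none => exact le_max_right _ _
  | some i => exact le_max_of_le_left (Finset.le_sup (f := fun i => (p i).totalDegree) (Finset.mem_univ i))

/-- The sharp map followed by the unitary map with columns `b`. -/
noncomputable def rotMap (r : ℕ) (b : Fin (r + 2) → EuclideanSpace ℂ (Fin (r + 2)))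
    (i : Fin (r + 2)) : MvPolynomial (Fin 2) ℂ :=
  ∑ j, C (b j i) * sharpMap r j

theorem eval_bind_rotMap (r : ℕ) 
    (b : OrthonormalBasis (Fin (r + 2)) ℂ (EuclideanSpace ℂ (Fin (r + 2)))) (z : Fin 2 → ℂ) :
    ∃ w : EuclideanSpace ℂ (Fin (r + 2)), ‖w‖ ^ 2 = ∑ j, ‖eval z (sharpMap r j)‖ ^ 2 ∧
      ∀ P, eval z (bind₁ (rotMap r b) P) = eval (fun i => w i) P := by
  refine ⟨b.repr.symm (WithLp.toLp 2 fun j => eval z (sharpMap r j)), ?_, ?_⟩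
  · rw [LinearIsometryEquiv.norm_map, EuclideanSpace.norm_sq_eq]
  · intro P
    have : (fun i => eval z (rotMap r b i)) =
        fun i => (b.repr.symm (WithLp.toLp 2 fun j => eval z (sharpMap r j))) i := by
      ext i
      rw [← OrthonormalBasis.sum_repr_symm]
      simp [rotMap, mul_comm]
    rw [← this]
    induction P using MvPolynomial.induction_on with
    | C c => simp
    | add p q hp hq => simp [hp, hq]
    | mul_X p i hp => simp [hp]

theorem axisRes_bind_rotMap (r : ℕ) (b : Fin (r + 2) → EuclideanSpace ℂ (Fin (r + 2)))
    (a : Fin (r + 2) → ℂ) (c : ℂ) (hb : ∀ i, b 0 i = c * a i) (P : MvPolynomial (Fin (r + 2)) ℂ) :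
    axisRes (bind₁ (rotMap r b) P) =
      (lineRes a P).comp (Polynomial.C c * Polynomial.X ^ (2 * r + 1)) := by
  have h1 : ∀ i, axisRes (rotMap r b i) =
      (Polynomial.C (a i) * Polynomial.X).comp (Polynomial.C c * Polynomial.X ^ (2 * r + 1)) := by
    intro i
    simp only [rotMap, map_sum, map_mul, axisRes_sharpMap, algHom_C, mul_ite, mul_zero,
      Finset.sum_ite_eq', Finset.sum_ite_eq, Finset.mem_univ, if_true, hb]
    simp [← Polynomial.C_eq_algebraMap]
    ring
  induction P using MvPolynomial.induction_on with
  | C k => simp [algHom_C, ← Polynomial.C_eq_algebraMap]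
  | add p q hp hq => simp [hp, hq]
  | mul_X p i hp =>
    rw [map_mul, map_mul, hp, bind₁_X_right, h1, map_mul, Polynomial.mul_comp]
    congr 2
    simp [lineRes]

theorem exists_basis (r : ℕ) (a : Fin (r + 2) → ℂ) (ha : a ≠ 0) :
    ∃ (b : OrthonormalBasis (Fin (r + 2)) ℂ (EuclideanSpace ℂ (Fin (r + 2)))) (c : ℂ),
      c ≠ 0 ∧ ∀ i, b 0 i = c * a i := by
  let v : EuclideanSpace ℂ (Fin (r + 2)) := WithLp.toLp 2 a
  have hv : v ≠ 0 := by
    intro h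
    apply ha
    ext i
    exact congrArg (fun w : EuclideanSpace ℂ (Fin (r + 2)) => w i) h
  have hv' : ‖v‖ ≠ 0 := norm_ne_zero_iff.mpr hv
  let u : EuclideanSpace ℂ (Fin (r + 2)) := ((‖v‖ : ℂ)⁻¹) • v
  have hu : ‖u‖ = 1 := by
    simp only [u, norm_smul, norm_inv, Complex.norm_real, norm_norm]
    exact inv_mul_cancel₀ hv'
  have ho : Orthonormal ℂ (({0} : Set (Fin (r + 2))).domRestrict fun _ => u) := by
    refine ⟨fun i => hu, fun i j hij => ?_⟩
    exact absurd (Subtype.ext (i.2.trans j.2.symm)) hij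
  obtain ⟨b, hb⟩ := ho.exists_orthonormalBasis_extension_of_card_eq (by simp)
  refine ⟨b, (‖v‖ : ℂ)⁻¹, inv_ne_zero (by exact_mod_cast hv'), fun i => ?_⟩
  rw [hb 0 rfl]
  rfl

/-- If every rational proper map from `B_2` to `B_N` in lowest terms has degree at
most `C`, then every rational proper map from `B_n` to `B_N` in lowest terms
(`n ≥ 2`) of degree `d` satisfies `d ≤ C / (2n - 3)`. -/
theorem degree_bound_pullback (N : ℕ) (hN : 2 ≤ N) (C : ℝ)
    (H : ∀ (p : Fin N → MvPolynomial (Fin 2) ℂ) (q : MvPolynomial (Fin 2) ℂ),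
      IsRationalProperBallMap 2 N p q → (rationalDegree 2 N p q : ℝ) ≤ C)
    (n : ℕ) (hn : 2 ≤ n)
    (p : Fin N → MvPolynomial (Fin n) ℂ) (q : MvPolynomial (Fin n) ℂ)
    (hpq : IsRationalProperBallMap n N p q) (d : ℕ)
    (hd : rationalDegree n N p q = d) :
    (d : ℝ) ≤ C / (2 * (n : ℝ) - 3) := by
  obtain ⟨r, rfl⟩ : ∃ r, n = r + 2 := ⟨n - 2, by omega⟩
  obtain ⟨hq0, hcop, hball, hsph⟩ := hpq
  obtain ⟨j, hj⟩ := exists_degree_member (r + 2) N p q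
  obtain ⟨a, ha, ⟨A, hA⟩, hdeg⟩ := generic_line (0 : Fin (r + 2))
    (fun i : Option (Fin N) => i.elim q p) none
    (by simpa using hq0 0 (by simp))
    (fun s hs => hcop s (hs none) fun i => hs (some i)) j
  rw [hj, hd] at hdeg
  obtain ⟨b, c, hc, hb⟩ := exists_basis r a ha
  let β := bind₁ (rotMap r b)
  have hzn : ∀ z : EuclideanSpace ℂ (Fin 2), ‖z‖ ^ 2 = ‖z 0‖ ^ 2 + ‖z 1‖ ^ 2 := by
    intro z
    rw [EuclideanSpace.norm_sq_eq, Fin.sum_univ_two]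
  have hw1 : ∀ z : EuclideanSpace ℂ (Fin 2), ‖z‖ < 1 → 
      ∃ w : EuclideanSpace ℂ (Fin (r + 2)), ‖w‖ < 1 ∧
        ∀ P, eval (fun i => z i) (β P) = eval (fun i => w i) P := by
    intro z hz
    obtain ⟨w, hw, hP⟩ := eval_bind_rotMap r b (fun i => z i)
    refine ⟨w, ?_, hP⟩
    have : ‖w‖ ^ 2 < 1 := by
      rw [hw]
      apply sharpMap_ball
      rw [← hzn]
      exact pow_lt_one₀ (norm_nonneg _) hz two_ne_zero
    exact (sq_lt_one_iff₀ (norm_nonneg _)).mp this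
  have hw2 : ∀ z : EuclideanSpace ℂ (Fin 2), ‖z‖ = 1 → 
      ∃ w : EuclideanSpace ℂ (Fin (r + 2)), ‖w‖ = 1 ∧
        ∀ P, eval (fun i => z i) (β P) = eval (fun i => w i) P := by
    intro z hz
    obtain ⟨w, hw, hP⟩ := eval_bind_rotMap r b (fun i => z i)
    refine ⟨w, ?_, hP⟩
    have : ‖w‖ ^ 2 = 1 := by
      rw [hw]
      apply sharpMap_sphere
      rw [← hzn, hz, one_pow]
    exact (pow_eq_one_iff_of_nonneg (norm_nonneg _) two_ne_zero).mp this
  have hβq : ∀ z : EuclideanSpace ℂ (Fin 2), ‖z‖ ≤ 1 → eval (fun i => z i) (β q) ≠ 0 := by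
    intro z hz
    rcases hz.lt_or_eq with h | h
    · obtain ⟨w, hw, hP⟩ := hw1 z h
      rw [hP]; exact hq0 w hw.le
    · obtain ⟨w, hw, hP⟩ := hw2 z h
      rw [hP]; exact hq0 w hw.le
  have hβq0 : β q ≠ 0 := by
    intro h
    apply hβq 0 (by simp)
    rw [h, map_zero]
  obtain ⟨h, p', q', hp', hq', hcop'⟩ := exists_max_common_dvd (fun i => β (p i)) (β q) hβq0
  have hhq : ∀ z : EuclideanSpace ℂ (Fin 2), ‖z‖ ≤ 1 →
      eval (fun i => z i) h ≠ 0 ∧ eval (fun i => z i) q' ≠ 0 := by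
    intro z hz
    have := hβq z hz
    rw [hq', map_mul] at this
    exact ⟨left_ne_zero_of_mul this, right_ne_zero_of_mul this⟩
  have hsum : ∀ z : EuclideanSpace ℂ (Fin 2), ∀ w : EuclideanSpace ℂ (Fin (r + 2)),
      (∀ P, eval (fun i => z i) (β P) = eval (fun i => w i) P) →
      ∑ i, ‖eval (fun j => w j) (p i)‖ ^ 2 =
        ‖eval (fun i => z i) h‖ ^ 2 * ∑ i, ‖eval (fun j => z j) (p' i)‖ ^ 2 ∧
      ‖eval (fun j => w j) q‖ ^ 2 =
        ‖eval (fun i => z i) h‖ ^ 2 * ‖eval (fun j => z j) q'‖ ^ 2 := by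
    intro z w hP
    constructor
    · rw [Finset.mul_sum]
      refine Finset.sum_congr rfl fun i _ => ?_
      rw [← hP, hp', map_mul, norm_mul, mul_pow]
    · rw [← hP, hq', map_mul, norm_mul, mul_pow]
  have hprop : IsRationalProperBallMap 2 N p' q' := by
    refine ⟨fun z hz => (hhq z hz).2, hcop', fun z hz => ?_, fun z hz => ?_⟩
    · obtain ⟨w, hw, hP⟩ := hw1 z hz
      have h1 := hball w hw
      rw [(hsum z w hP).1, (hsum z w hP).2] at h1
      exact lt_of_mul_lt_mul_left h1 (by positivity)
    · obtain ⟨w, hw, hP⟩ := hw2 z hz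
      have h1 := hsph w hw
      rw [(hsum z w hP).1, (hsum z w hP).2] at h1
      have h2 := norm_ne_zero_iff.mpr (hhq z hz.le).1
      exact mul_left_cancel₀ (pow_ne_zero 2 h2) h1
  have hC := H p' q' hprop
  -- factorization of all members
  have hfac : ∀ i : Option (Fin N), β (i.elim q p) = h * i.elim q' p' := by
    intro i
    cases i with
    | none => exact hq'
    | some i => exact hp' i
  let s : Polynomial ℂ := Polynomial.C c * Polynomial.X ^ (2 * r + 1)
  have hax : ∀ P, axisRes (β P) = (lineRes a P).comp s := axisRes_bind_rotMap r b a c hb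
  have hunit : IsUnit (axisRes h) := by
    have h1 := congrArg (fun P => Polynomial.comp P s) hA
    simp only [Polynomial.sum_comp, Polynomial.mul_comp, Polynomial.one_comp] at h1
    apply isUnit_of_dvd_one
    rw [← h1]
    refine Finset.dvd_sum fun i _ => ?_
    rw [← hax, hfac, map_mul]
    exact Dvd.dvd.mul_left (dvd_mul_right _ _) _
  have hs : s.natDegree = 2 * r + 1 := Polynomial.natDegree_C_mul_X_pow _ _ hc
  have hfin : d * (2 * r + 1) ≤ rationalDegree 2 N p' q' := by
    refine le_trans ?_ (le_rationalDegree 2 N p' q' j)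
    refine le_trans ?_ (axisRes_natDegree_le _)
    have h1 : ((lineRes a (j.elim q p)).comp s).natDegree = (axisRes (j.elim q' p')).natDegree := by
      rw [← hax, hfac, map_mul]
      obtain ⟨u, hu, hu'⟩ := Polynomial.isUnit_iff.mp hunit
      rw [← hu', Polynomial.natDegree_C_mul hu.ne_zero]
    rw [← h1, Polynomial.natDegree_comp, hs]
    exact Nat.mul_le_mul_right _ hdeg
  have hfin' : ((d * (2 * r + 1) : ℕ) : ℝ) ≤ C := le_trans (by exact_mod_cast hfin) hC
  push_cast at hfin' ⊢
  rw [le_div_iff₀ (by have : (0 : ℝ) ≤ r := Nat.cast_nonneg r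
                      linarith)]
  have e : 2 * ((r : ℝ) + 2) - 3 = 2 * r + 1 := by ring
  rw [e]
  exact hfin'
end

section
/- Let p = (p_1,…,p_N) : ℂ^n → ℂ^N be a polynomial map such that ‖p(z)‖ = 1 for every z ∈ ℂ^n with ‖z‖ = 1. Then for every z with ‖z‖ < 1 and p(z) = 0, one has z = 0; that is, the zero set of p in the open unit ball is either empty or equal to {0}. -/
open MvPolynomial

lemma one_var_aux (N : ℕ) (q : Fin N → Polynomial ℂ)
    (hq : ∀ t : ℂ, ‖t‖ = 1 → ∑ i, ‖(q i).eval t‖ ^ 2 = 1)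
    (a : ℂ) (ha : ∀ i, (q i).eval a = 0) : a = 0 := by
  set d := Finset.univ.sup (fun i => (q i).natDegree) with hd
  have hdeg : ∀ i, (q i).natDegree ≤ d := fun i =>
    Finset.le_sup (f := fun i => (q i).natDegree) (Finset.mem_univ i)
  have key : ∑ i, q i * Polynomial.reflect d ((q i).map (starRingEnd ℂ)) = Polynomial.X ^ d := by
    apply Polynomial.eq_of_infinite_eval_eq
    have hinf : (Metric.sphere (0 : ℂ) 1).Infinite := by
      refine IsPreconnected.infinite_of_nontrivial
        (isPreconnected_sphere (by rw [Complex.rank_real_complex]; norm_num) 0 1) ?_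
      exact ⟨1, by simp, -1, by simp, by norm_num⟩
    refine hinf.mono ?_
    intro t ht
    have ht1 : ‖t‖ = 1 := by simpa using ht
    have ht0 : t ≠ 0 := by
      rintro rfl
      simp at ht1
    have hinv : t⁻¹ = (starRingEnd ℂ) t := Complex.inv_eq_conj ht1
    have h1 : ∀ i, (Polynomial.reflect d ((q i).map (starRingEnd ℂ))).eval t
        = (starRingEnd ℂ) ((q i).eval t) * t ^ d := by
      intro i
      let _ : Invertible (t⁻¹) := invertibleOfNonzero (inv_ne_zero ht0)
      have h := Polynomial.eval₂_reflect_mul_pow (RingHom.id ℂ) (t⁻¹) d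
        ((q i).map (starRingEnd ℂ)) (Polynomial.natDegree_map_le.trans (hdeg i))
      rw [invOf_eq_inv, inv_inv, Polynomial.eval₂_id, Polynomial.eval₂_id, hinv,
        Polynomial.eval_map, Polynomial.eval₂_hom, ← hinv] at h
      rw [← h, mul_assoc, ← mul_pow, inv_mul_cancel₀ ht0, one_pow, mul_one]
    have h2 := hq t ht1
    have h3 : ∑ i, (q i).eval t * (starRingEnd ℂ) ((q i).eval t) = 1 := by
      simp_rw [Complex.mul_conj']
      exact_mod_cast h2
    simp only [Set.mem_ofPred_eq, Polynomial.eval_finsetSum, Polynomial.eval_mul, h1,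
      Polynomial.eval_pow, Polynomial.eval_X]
    simp_rw [← mul_assoc]
    rw [← Finset.sum_mul, h3, one_mul]
  have h := congrArg (Polynomial.eval a) key
  simp only [Polynomial.eval_finsetSum, Polynomial.eval_mul, ha, zero_mul, Finset.sum_const_zero,
    Polynomial.eval_pow, Polynomial.eval_X] at h
  exact eq_zero_of_pow_eq_zero h.symm

/-- If `p` is a proper polynomial map between balls (i.e. `‖p(z)‖ = 1` on the unit
sphere), then the only possible zero of `p` in the open unit ball is the origin. -/
theorem polynomial_proper_zero_set
    (n N : ℕ) (p : Fin N → MvPolynomial (Fin n) ℂ)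
    (hp : ∀ z : EuclideanSpace ℂ (Fin n), ‖z‖ = 1 →
      ∑ i, ‖eval (fun j => z j) (p i)‖ ^ 2 = 1)
    (z : EuclideanSpace ℂ (Fin n)) (hz : ‖z‖ < 1)
    (hz0 : ∀ i, eval (fun j => z j) (p i) = 0) :
    z = 0 := by
  by_contra hne
  have hn : ‖z‖ ≠ 0 := norm_ne_zero_iff.mpr hne
  set u : EuclideanSpace ℂ (Fin n) := ((‖z‖ : ℂ)⁻¹) • z with hu
  have hun : ‖u‖ = 1 := by
    rw [hu, norm_smul, norm_inv, Complex.norm_real, norm_norm, inv_mul_cancel₀ hn]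
  have hev : ∀ (i : Fin N) (t : ℂ),
      (aeval (fun j => Polynomial.C (u j) * Polynomial.X) (p i) : Polynomial ℂ).eval t
        = eval (fun j => (t • u) j) (p i) := by
    intro i t
    induction p i using MvPolynomial.induction_on with
    | C a => simp
    | add f g hf hg => rw [map_add, Polynomial.eval_add, hf, hg, map_add]
    | mul_X f j hf =>
      rw [map_mul, Polynomial.eval_mul, hf, map_mul, aeval_X, eval_X]
      simp only [Polynomial.eval_mul, Polynomial.eval_C, Polynomial.eval_X, PiLp.smul_apply,
        smul_eq_mul]
      ring
  have h := one_var_aux N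
    (fun i => (aeval (fun j => Polynomial.C (u j) * Polynomial.X) (p i) : Polynomial ℂ))
    (fun t ht => by
      simp_rw [hev]
      exact hp _ (by rw [norm_smul, ht, hun, one_mul]))
    (‖z‖ : ℂ)
    (fun i => by
      have hzu : (‖z‖ : ℂ) • u = z := by
        rw [hu, smul_smul, mul_inv_cancel₀ (by exact_mod_cast hn), one_smul]
      simp only [hev, hzu]
      exact hz0 i)
  exact hn (by exact_mod_cast h)
end

section
/- Let q be a polynomial on ℂ^n of degree d−1 that does not vanish at any point of the closed unit ball, with homogeneous expansion q = Σ_{j=0}^{d−1} q_j. Let f = p/q be a rational proper map from B_n to B_N in lowest terms. Then every z ∈ B_n with p(z) = 0 belongs to S(q) = {z ∈ ℂ^n : Hq(w,z) = 0 for all w ∈ ℂ^n}, where Hq(w,z) = Σ_{j=0}^{d−1} ⟨w,z⟩^{d−j}·q_j(w). In particular, if q = 1 then S(q) = {0}. -/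
open MvPolynomial

/-- The homogenization `Hq(w,z) = Σ_{j=0}^{d-1} ⟨w,z⟩^{d-j} q_j(w)` of a polynomial
`q = Σ_{j=0}^{d-1} q_j` of degree `d-1`, where `⟨w,z⟩ = Σ_l w_l conj(z_l)` and
`q_j` is the homogeneous part of `q` of degree `j`. -/
noncomputable def homogenizedH (n d : ℕ) (q : MvPolynomial (Fin n) ℂ)
    (w : Fin n → ℂ) (z : EuclideanSpace ℂ (Fin n)) : ℂ :=
  ∑ j ∈ Finset.range d,
    (∑ l, w l * (starRingEnd ℂ) (z l)) ^ (d - j) *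
      eval w (homogeneousComponent j q)

open Filter Topology in
lemma aux_diff {n : ℕ} (p : MvPolynomial (Fin n) ℂ) (c v : Fin n → ℂ) :
    Differentiable ℂ (fun s : ℂ => eval (fun j => c j + s * v j) p) := by
  induction p using MvPolynomial.induction_on with
  | C a => simp
  | add p q hp hq =>
    simp only [map_add]
    exact hp.add hq
  | mul_X p i hp =>
    simp only [map_mul, eval_X]
    exact hp.mul (by fun_prop)

lemma aux_conj {n : ℕ} (p : MvPolynomial (Fin n) ℂ) (x : Fin n → ℂ) :
    eval (fun j => (starRingEnd ℂ) (x j)) (map (starRingEnd ℂ) p) =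
      (starRingEnd ℂ) (eval x p) := by
  induction p using MvPolynomial.induction_on with
  | C a => simp
  | add p q hp hq => simp [hp, hq]
  | mul_X p i hp => simp [hp]

open Filter Topology in
lemma aux_identity (F : ℂ → ℂ) (ρ : ℝ) (hρ : 0 < ρ) (hF : DifferentiableOn ℂ F {0}ᶜ)
    (h : ∀ s : ℂ, ‖s‖ ^ 2 = ρ → F s = 0) (s : ℂ) (hs : s ≠ 0) : F s = 0 := by
  have hr : 0 < Real.sqrt ρ := Real.sqrt_pos.mpr hρ
  have hA : AnalyticOnNhd ℂ F {0}ᶜ := hF.analyticOnNhd isOpen_compl_singleton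
  have hconn : IsPreconnected ({0}ᶜ : Set ℂ) :=
    (isConnected_compl_singleton_of_one_lt_rank (by simp) 0).isPreconnected
  have hd : HasDerivAt (fun θ : ℝ => (Real.sqrt ρ : ℂ) * Complex.exp (θ * Complex.I))
      ((Real.sqrt ρ : ℂ) * (Complex.exp ((0:ℝ) * Complex.I) * (1 * Complex.I))) 0 := by
    have h1 : HasDerivAt (fun θ : ℝ => (θ : ℂ) * Complex.I) (1 * Complex.I) (0:ℝ) :=
      (Complex.ofRealCLM.hasDerivAt (x := (0:ℝ))).mul_const Complex.I
    exact (h1.cexp).const_mul _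
  have ht := hd.tendsto_nhdsNE (by simp [hr.ne'])
  have hfr := ht.frequently (p := fun s => F s = 0) (Eventually.frequently (by
    refine Eventually.of_forall fun θ => h _ ?_
    rw [norm_mul, Complex.norm_exp_ofReal_mul_I, mul_one, Complex.norm_real,
      Real.norm_of_nonneg hr.le, Real.sq_sqrt hρ.le]))
  exact hA.eqOn_zero_of_preconnected_of_frequently_eq_zero hconn (by simp [hr.ne']) hfr hs

lemma aux_inner {n : ℕ} (x : EuclideanSpace ℂ (Fin n)) :
    inner ℂ x x = ((‖x‖ ^ 2 : ℝ) : ℂ) := by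
  rw [inner_self_eq_norm_sq_to_K]; push_cast; rfl

lemma aux_polar {n N : ℕ} (q : MvPolynomial (Fin n) ℂ) (p : Fin N → MvPolynomial (Fin n) ℂ)
    (hsphere : ∀ z : EuclideanSpace ℂ (Fin n), ‖z‖ = 1 →
      ∑ i, ‖eval (fun j => z j) (p i)‖ ^ 2 = ‖eval (fun j => z j) q‖ ^ 2)
    (z w : EuclideanSpace ℂ (Fin n)) (hz : ‖z‖ < 1) (hwz : inner ℂ z w = 1) :
    ∑ i, eval (fun j => w j) (p i) * (starRingEnd ℂ) (eval (fun j => z j) (p i)) =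
      eval (fun j => w j) q * (starRingEnd ℂ) (eval (fun j => z j) q) := by
  obtain ⟨v, hv⟩ : ∃ v, v = w - z := ⟨_, rfl⟩
  have hzz : ‖z‖ ^ 2 < 1 := by nlinarith [norm_nonneg z]
  have hv0 : v ≠ 0 := by
    rintro rfl
    have : w = z := by rw [eq_comm, sub_eq_zero] at hv; exact hv
    subst this
    rw [aux_inner] at hwz
    have : ‖w‖ ^ 2 = 1 := by exact_mod_cast hwz
    linarith
  have hvn : 0 < ‖v‖ ^ 2 := by have := norm_pos_iff.mpr hv0; positivity
  have hvc : ((‖v‖ ^ 2 : ℝ) : ℂ) ≠ 0 := by exact_mod_cast hvn.ne'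
  obtain ⟨α, hα⟩ : ∃ α : ℂ, α = inner ℂ v z / ((‖v‖ ^ 2 : ℝ) : ℂ) := ⟨_, rfl⟩
  obtain ⟨c, hc⟩ : ∃ c, c = z - α • v := ⟨_, rfl⟩
  have hvv : inner ℂ v v = ((‖v‖ ^ 2 : ℝ) : ℂ) := aux_inner _
  have hcc : inner ℂ c c = ((‖c‖ ^ 2 : ℝ) : ℂ) := aux_inner _
  have hvc0 : inner ℂ v c = 0 := by
    rw [hc, inner_sub_right, inner_smul_right, hvv, hα, div_mul_cancel₀ _ hvc, sub_self]
  have hcv0 : inner ℂ c v = 0 := by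
    rw [← inner_conj_symm, hvc0, map_zero]
  have hin : ∀ s t : ℂ, inner ℂ (c + t • v) (c + s • v) =
      ((‖c‖ ^ 2 : ℝ) : ℂ) + (starRingEnd ℂ) t * s * ((‖v‖ ^ 2 : ℝ) : ℂ) := by
    intro s t
    simp only [inner_add_left, inner_add_right, inner_smul_left, inner_smul_right, hvc0, hcv0,
      hvv, hcc]
    ring
  have hnorm : ∀ s : ℂ, ‖c + s • v‖ ^ 2 = ‖c‖ ^ 2 + ‖s‖ ^ 2 * ‖v‖ ^ 2 := by
    intro s
    have h1 := hin s s
    rw [aux_inner, Complex.conj_mul'] at h1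
    exact_mod_cast h1
  have hzc : z = c + α • v := by rw [hc]; abel
  have hwc : w = c + (α + 1) • v := by
    rw [add_smul, one_smul, ← add_assoc, ← hzc, hv]; abel
  obtain ⟨ρ, hρ⟩ : ∃ ρ : ℝ, ρ = (1 - ‖c‖ ^ 2) / ‖v‖ ^ 2 := ⟨_, rfl⟩
  have hrho : ρ * ‖v‖ ^ 2 = 1 - ‖c‖ ^ 2 := by rw [hρ]; field_simp
  have hρ0 : 0 < ρ := by
    rw [hρ]
    apply div_pos _ hvn
    have := hnorm α
    rw [← hzc] at this
    nlinarith [mul_nonneg (sq_nonneg ‖α‖) hvn.le]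
  have hαρ : (starRingEnd ℂ) α * (α + 1) = ρ := by
    have h1 := hin (α + 1) α
    rw [← hzc, ← hwc, hwz] at h1
    have h2 : (ρ : ℂ) * ((‖v‖ ^ 2 : ℝ) : ℂ) = 1 - ((‖c‖ ^ 2 : ℝ) : ℂ) := by
      exact_mod_cast congrArg (fun x : ℝ => (x : ℂ)) hrho
    apply mul_right_cancel₀ hvc
    rw [h2]; linear_combination -h1
  have hs0 : α + 1 ≠ 0 := by
    intro h
    rw [h, mul_zero] at hαρ
    exact hρ0.ne (by exact_mod_cast hαρ)

  let G : MvPolynomial (Fin n) ℂ → ℂ → ℂ := fun r s =>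
    eval (fun j => c j + s * v j) r *
      eval (fun j => (starRingEnd ℂ) (c j) + (ρ / s) * (starRingEnd ℂ) (v j))
        (map (starRingEnd ℂ) r)
  have hGdiff : ∀ r, DifferentiableOn ℂ (G r) {0}ᶜ := by
    intro r
    refine (aux_diff r _ _).differentiableOn.mul ?_
    have h1 : DifferentiableOn ℂ (fun s : ℂ => (ρ : ℂ) / s) {0}ᶜ :=
      (differentiableOn_const _).div differentiableOn_id (fun s hs => hs)
    exact (aux_diff (map (starRingEnd ℂ) r) (fun j => (starRingEnd ℂ) (c j))
      (fun j => (starRingEnd ℂ) (v j))).comp_differentiableOn h1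
  have hG : ∀ r s t, (starRingEnd ℂ) t = ρ / s → G r s =
      eval (fun j => (c + s • v) j) r * (starRingEnd ℂ) (eval (fun j => (c + t • v) j) r) := by
    intro r s t hst
    simp only [G]
    rw [← aux_conj, ← hst]
    simp
  have key := aux_identity (fun s => ∑ i, G (p i) s - G q s) ρ hρ0
    ((DifferentiableOn.fun_sum fun i _ => hGdiff (p i)).sub (hGdiff q)) (by
      intro s hs
      have hsne : s ≠ 0 := by
        rintro rfl
        simp at hs
        exact hρ0.ne hs
      have hst : (starRingEnd ℂ) s = ρ / s := by
        rw [eq_div_iff hsne, Complex.conj_mul', ← hs]; push_cast; rfl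
      have h1 := hsphere (c + s • v) (by
        have := hnorm s
        rw [hs, hrho] at this
        have h2 : ‖c + s • v‖ ^ 2 = 1 := by linarith
        exact (pow_eq_one_iff_of_nonneg (norm_nonneg _) two_ne_zero).mp h2)
      simp only [hG _ s s hst, Complex.mul_conj']
      rw [sub_eq_zero]
      exact_mod_cast h1) (α + 1) hs0
  have hst : (starRingEnd ℂ) α = ρ / (α + 1) := by rw [eq_div_iff hs0, hαρ]
  simp only [hG _ _ α hst, ← hzc, ← hwc] at key
  exact sub_eq_zero.mp key

lemma aux_homog {n : ℕ} (q : MvPolynomial (Fin n) ℂ) (j : ℕ) (a : ℂ) (w : Fin n → ℂ) :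
    eval (fun l => a * w l) (homogeneousComponent j q) =
      a ^ j * eval w (homogeneousComponent j q) := by
  rw [eval_eq, eval_eq, Finset.mul_sum]
  refine Finset.sum_congr rfl fun m hm => ?_
  have h := (homogeneousComponent_isHomogeneous j q) (mem_support_iff.mp hm)
  have hsum : ∑ i, m i = j := by
    rw [← h, Finsupp.weight_apply, Finsupp.sum_fintype] <;> simp
  have hsupp : ∑ i ∈ m.support, m i = j := by
    rw [← hsum]
    exact Finset.sum_subset (Finset.subset_univ _)
      (fun i _ hi => Finsupp.notMem_support_iff.mp hi)
  simp only [mul_pow, Finset.prod_mul_distrib, Finset.prod_pow_eq_pow_sum, hsupp]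
  ring

/-- The zeros in the ball of the numerator of a rational proper map `p/q` between
balls in lowest terms all lie in the finite set `S(q)` of points `z` for which
`Hq(·,z)` vanishes identically; in particular if `q = 1` then `S(q) = {0}`. -/
theorem zeros_of_numerator_in_Sq
    (n N d : ℕ) (q : MvPolynomial (Fin n) ℂ)
    (hdeg : q.totalDegree + 1 = d)
    (hq : ∀ z : EuclideanSpace ℂ (Fin n), ‖z‖ ≤ 1 → eval (fun i => z i) q ≠ 0)
    (p : Fin N → MvPolynomial (Fin n) ℂ)
    (hlow : ∀ r : MvPolynomial (Fin n) ℂ, r ∣ q → (∀ i, r ∣ p i) →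
      r.totalDegree = 0)
    (hball : ∀ z : EuclideanSpace ℂ (Fin n), ‖z‖ < 1 →
      ∑ i, ‖eval (fun j => z j) (p i)‖ ^ 2 < ‖eval (fun j => z j) q‖ ^ 2)
    (hsphere : ∀ z : EuclideanSpace ℂ (Fin n), ‖z‖ = 1 →
      ∑ i, ‖eval (fun j => z j) (p i)‖ ^ 2 = ‖eval (fun j => z j) q‖ ^ 2) :
    (∀ z : EuclideanSpace ℂ (Fin n), ‖z‖ < 1 →
      (∀ i, eval (fun j => z j) (p i) = 0) →
      ∀ w : Fin n → ℂ, homogenizedH n d q w z = 0) ∧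
    (q = 1 →
      {z : EuclideanSpace ℂ (Fin n) | ∀ w : Fin n → ℂ, homogenizedH n d q w z = 0}
        = {0}) := by
  constructor
  · intro z hz hp w
    unfold homogenizedH
    have hlin : ∀ w : Fin n → ℂ, inner ℂ z (WithLp.toLp 2 w : EuclideanSpace ℂ (Fin n)) =
        ∑ l, w l * (starRingEnd ℂ) (z l) := by
      intro w
      simp [PiLp.inner_apply]
    rcases eq_or_ne (∑ l, w l * (starRingEnd ℂ) (z l)) 0 with h0 | h0
    · rw [h0]
      refine Finset.sum_eq_zero fun j hj => ?_
      rw [zero_pow (by have := Finset.mem_range.mp hj; omega), zero_mul]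
    · obtain ⟨a, ha⟩ : ∃ a, a = ∑ l, w l * (starRingEnd ℂ) (z l) := ⟨_, rfl⟩
      rw [← ha] at h0 ⊢
      have h1 := aux_polar q p hsphere z (WithLp.toLp 2 (fun l => a⁻¹ * w l)) hz (by
        rw [hlin]
        simp only [mul_assoc]
        rw [← Finset.mul_sum, ← ha, inv_mul_cancel₀ h0])
      simp only [hp, map_zero, mul_zero, Finset.sum_const_zero] at h1
      have h2 : eval (fun l => a⁻¹ * w l) q = 0 := by
        rcases mul_eq_zero.mp h1.symm with h | h
        · exact h
        · exact absurd ((map_eq_zero _).mp h) (hq z hz.le)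
      rw [← sum_homogeneousComponent q, map_sum, hdeg] at h2
      calc _ = a ^ d * ∑ j ∈ Finset.range d,
            eval (fun l => a⁻¹ * w l) (homogeneousComponent j q) := by
            rw [Finset.mul_sum]
            refine Finset.sum_congr rfl fun j hj => ?_
            rw [aux_homog, ← mul_assoc, pow_sub₀ _ h0 (Finset.mem_range.mp hj).le, inv_pow]
        _ = 0 := by rw [h2, mul_zero]
  · rintro rfl
    have hd : d = 1 := by rw [← hdeg]; simp
    subst hd
    ext z
    simp only [Set.mem_ofPred_eq, Set.mem_singleton_iff, homogenizedH, Finset.sum_range_one,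
      homogeneousComponent_zero]
    constructor
    · intro h
      have h1 := h (fun l => z l)
      rw [← inner_self_eq_zero (𝕜 := ℂ)]
      rw [PiLp.inner_apply]
      simpa [Complex.mul_conj'] using h1
    · rintro rfl
      simp
end
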